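/- arXiv:math/9711208 — 4 statements merged into one kernel-verified Lean document; each statement's English description precedes it below -/
import Mathlib

section
/- Let X be a locally compact Hausdorff space and let Φ be an automorphism (i.e., a multiplicative linear bijection) of C₀(X, B(H)). Then there exist a function τ : X → Aut(B(H)) and a bijection φ : X → X such that Φ(f)(x) = [τ(x)](f(φ(x))) for every f ∈ C₀(X, B(H)) and every x ∈ X; moreover, the maps x ↦ τ(x) and x ↦ τ(x)⁻¹ are strongly continuous (i.e., x ↦ [τ(x)](A) and x ↦ [τ(x)⁻¹](A) are norm-continuous for every A ∈ B(H)) and φ is a homeomorphism of X. -/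
open scoped ZeroAtInfty

/-- An automorphism of a (not necessarily unital) algebra: a multiplicative linear bijection. -/
def IsAlgebraAutomorphism {A : Type*} [NonUnitalNonAssocSemiring A] [Module ℂ A]
    (Φ : A → A) : Prop :=
  IsLinearMap ℂ Φ ∧ (∀ a b : A, Φ (a * b) = Φ a * Φ b) ∧ Function.Bijective Φ

open Filter Topology ComplexOrder in
theorem auxPos {X : Type*} [TopologicalSpace X]
    (χ : C₀(X, ℂ) →ₙₐ[ℂ] ℂ) (h : ∀ y, ∃ k, χ k = 0 ∧ k y ≠ 0) (K : Set X) (hK : IsCompact K) :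
    ∃ s : C₀(X, ℂ), χ s = 0 ∧ (∀ x, 0 ≤ s x) ∧ ∀ x ∈ K, 0 < s x := by
  refine hK.induction_on (p := fun K => ∃ s : C₀(X, ℂ), χ s = 0 ∧ (∀ x, 0 ≤ s x) ∧ ∀ x ∈ K, 0 < s x)
    ?_ ?_ ?_ ?_
  · exact ⟨0, map_zero _, fun x => le_rfl, by simp⟩
  · intro s t hst ht
    obtain ⟨k, h1, h2, h3⟩ := ht
    exact ⟨k, h1, h2, fun x hx => h3 x (hst hx)⟩
  · intro s t hs ht
    obtain ⟨k, h1, h2, h3⟩ := hs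
    obtain ⟨k', h1', h2', h3'⟩ := ht
    refine ⟨k + k', by simp [h1, h1'], fun x => add_nonneg (h2 x) (h2' x), ?_⟩
    rintro x (hx | hx)
    · exact add_pos_of_pos_of_nonneg (h3 x hx) (h2' x)
    · exact add_pos_of_nonneg_of_pos (h2 x) (h3' x hx)
  · intro y hy
    obtain ⟨k, hk, hky⟩ := h y
    refine ⟨{x | k x ≠ 0}, mem_nhdsWithin_of_mem_nhds ?_, star k * k, by simp [hk], ?_, ?_⟩
    · exact k.continuous.continuousAt.eventually_ne hky
    · intro x
      exact star_mul_self_nonneg (k x)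
    · intro x hx
      have := star_mul_self_nonneg (k x)
      refine lt_of_le_of_ne this (Ne.symm ?_)
      simpa using hx

open Filter Topology ComplexOrder in
theorem auxBump {X : Type*} [TopologicalSpace X] [LocallyCompactSpace X] [T2Space X]
    (x : X) (U : Set X) (hU : IsOpen U) (hx : x ∈ U) :
    ∃ g : C₀(X, ℂ), (∀ᶠ y in 𝓝 x, g y = 1) ∧ ∀ y, y ∉ U → g y = 0 := by
  obtain ⟨K, hK, hxK, hKU⟩ := exists_compact_subset hU hx
  obtain ⟨f, h1, h0, hc, -⟩ := exists_continuous_one_zero_of_isCompact hK hU.isClosed_compl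
    (Set.disjoint_compl_right_iff_subset.2 hKU)
  have ht : Tendsto f (cocompact X) (𝓝 0) := by
    refine tendsto_const_nhds.congr' ?_
    have : (tsupport f)ᶜ ∈ cocompact X := hc.isCompact.compl_mem_cocompact
    filter_upwards [this] with y hy
    exact (image_eq_zero_of_notMem_tsupport hy).symm
  refine ⟨⟨⟨fun y => (f y : ℂ), by fun_prop⟩, ?_⟩, ?_, ?_⟩
  · have := (Complex.continuous_ofReal.tendsto 0).comp ht
    simpa [Function.comp_def] using this
  · filter_upwards [mem_interior_iff_mem_nhds.1 hxK] with y hy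
    have := h1 hy
    simp at this
    show (f y : ℂ) = 1
    rw [this]; simp
  · intro y hy
    have := h0 hy
    simp at this
    show (f y : ℂ) = 0
    rw [this]; simp

open Filter Topology ComplexOrder in
theorem auxChar {X : Type*} [TopologicalSpace X] [LocallyCompactSpace X] [T2Space X]
    (χ : C₀(X, ℂ) →ₙₐ[ℂ] ℂ) (hne : ∃ g, χ g ≠ 0) : ∃ y, ∀ g, χ g = g y := by
  obtain ⟨g', hg'⟩ := hne
  obtain ⟨g, hg⟩ : ∃ g, χ g = 1 := ⟨(χ g')⁻¹ • g', by simp [hg']⟩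
  obtain ⟨y, hy⟩ : ∃ y, ∀ k, χ k = 0 → k y = 0 := by
    by_contra! hcon
    have hlim : Tendsto g (cocompact X) (𝓝 0) := g.zero_at_infty'
    have hK : IsCompact {x | g x = 1} := by
      have : ∀ᶠ x in cocompact X, g x ≠ 1 := hlim.eventually_ne zero_ne_one
      obtain ⟨t, ht, hts⟩ := mem_cocompact'.1 this
      refine ht.of_isClosed_subset (isClosed_eq g.continuous continuous_const) ?_
      intro x hx
      exact hts (by simpa using hx)
    obtain ⟨s, hs, hs0, hsp⟩ := auxPos χ hcon _ hK
    have hslim : Tendsto s (cocompact X) (𝓝 0) := s.zero_at_infty'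
    have hsc := s.continuous
    have hgc := g.continuous
    have hD : ∀ x, star (1 - g x) * (1 - g x) + s x ≠ 0 := by
      intro x hx
      have h1 := star_mul_self_nonneg (1 - g x)
      have h2 := hs0 x
      have h3 : star (1 - g x) * (1 - g x) = 0 := by
        refine le_antisymm ?_ h1
        rw [← hx]; exact le_add_of_nonneg_right h2
      have h4 : s x = 0 := by rw [h3, zero_add] at hx; exact hx
      have h5 : 1 - g x = 0 := by
        rcases mul_eq_zero.1 h3 with h | h
        · exact star_eq_zero.1 h
        · exact h
      exact (hsp x (sub_eq_zero.1 h5).symm).ne' h4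
    have hDl : Tendsto (fun x => star (1 - g x) * (1 - g x) + s x) (cocompact X)
        (𝓝 (star (1 - 0) * (1 - 0) + 0)) :=
      (((tendsto_const_nhds.sub hlim).star).mul (tendsto_const_nhds.sub hlim)).add hslim
    have hDc : Continuous (fun x => star (1 - g x) * (1 - g x) + s x) := by fun_prop
    let b : C₀(X, ℂ) := ⟨⟨fun x => g x / (star (1 - g x) * (1 - g x) + s x), hgc.div hDc hD⟩, by
      have := hlim.div hDl (by simp)
      simpa [Pi.div_def] using this⟩
    let a : C₀(X, ℂ) := ⟨⟨fun x => star (1 - g x) * (g x / (star (1 - g x) * (1 - g x) + s x)),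
        (by fun_prop : Continuous fun x => star (1 - g x)).mul (hgc.div hDc hD)⟩, by
      have := ((tendsto_const_nhds (x := (1 : ℂ))).sub hlim).star.mul (hlim.div hDl (by simp))
      simpa [Pi.div_def] using this⟩
    have key : g * g = (g - g * g) * a + s * (b * g) := by
      ext x
      show g x * g x = (g x - g x * g x) *
        (star (1 - g x) * (g x / (star (1 - g x) * (1 - g x) + s x))) +
        s x * (g x / (star (1 - g x) * (1 - g x) + s x) * g x)
      have := hD x
      generalize star (1 - g x) = u at this ⊢
      generalize hd : u * (1 - g x) + s x = d at this ⊢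
      field_simp
      rw [← hd]
      ring
    have := congrArg χ key
    simp [hg, hs] at this
  refine ⟨y, ?_⟩
  have h1 : ∀ k, k y = χ k * g y := by
    intro k
    have := hy (k - χ k • g) (by simp [hg])
    simpa [sub_eq_zero] using this
  have h2 : g y = 1 := by
    obtain ⟨k, hk, -⟩ := auxBump y Set.univ isOpen_univ trivial
    have hk := hk.self_of_nhds
    have h3 := h1 k
    have hgy : g y ≠ 0 := by
      intro h; rw [h, hk] at h3; simp at h3
    have h4 := h1 (g * g)
    simp [hg] at h4
    exact mul_right_cancel₀ hgy (by simpa using h4)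
  intro k
  rw [h1 k, h2, mul_one]

section generic

set_option linter.unusedSectionVars false

variable {X : Type*} [TopologicalSpace X] [LocallyCompactSpace X] [T2Space X]
  {B : Type*} [NormedRing B] [NormedAlgebra ℂ B]

open Filter Topology in
/-- the function `x ↦ g x • A` in `C₀(X, B)`. -/
noncomputable def auxJ (g : C₀(X, ℂ)) (A : B) : C₀(X, B) :=
  ⟨⟨fun x => g x • A, g.continuous.smul continuous_const⟩, by
    have h : Tendsto g (cocompact X) (𝓝 0) := g.zero_at_infty'
    simpa using h.smul_const A⟩

@[simp] theorem auxJ_apply (g : C₀(X, ℂ)) (A : B) (x : X) : auxJ g A x = g x • A := rfl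

open Filter Topology in
theorem auxFactor (f : C₀(X, B)) : ∃ (g : C₀(X, ℂ)) (h : C₀(X, B)),
    f = auxJ g 1 * h ∧ ∀ y, f y = 0 → g y = 0 := by
  have hl : Tendsto f (cocompact X) (𝓝 0) := f.zero_at_infty'
  have hc := f.continuous
  have hsl : Tendsto (fun x => √‖f x‖) (cocompact X) (𝓝 0) := by
    simpa [Function.comp_def] using (Real.continuous_sqrt.tendsto _).comp hl.norm
  have hsc : Continuous (fun x => √‖f x‖) := by fun_prop
  let h : X → B := fun x => ((√‖f x‖ : ℝ) : ℂ)⁻¹ • f x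
  have hn : ∀ x, ‖h x‖ ≤ √‖f x‖ := by
    intro x
    simp only [h, norm_smul, norm_inv, Complex.norm_real, Real.norm_eq_abs,
      abs_of_nonneg (Real.sqrt_nonneg _)]
    by_cases hx : √‖f x‖ = 0
    · simp [hx]
    · rw [inv_mul_le_iff₀ (lt_of_le_of_ne (Real.sqrt_nonneg _) (Ne.symm hx)),
        Real.mul_self_sqrt (norm_nonneg _)]
  have hcont : Continuous h := by
    rw [continuous_iff_continuousAt]
    intro x
    by_cases hx : f x = 0
    · have h0 : h x = 0 := by simp [h, hx]
      have : Tendsto (fun x => √‖f x‖) (𝓝 x) (𝓝 0) := by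
        simpa [hx] using hsc.tendsto x
      rw [ContinuousAt, h0]
      exact squeeze_zero_norm hn this
    · refine ContinuousAt.smul (ContinuousAt.inv₀ (by fun_prop) ?_) hc.continuousAt
      simpa [Real.sqrt_eq_zero'] using hx
  refine ⟨⟨⟨fun x => ((√‖f x‖ : ℝ) : ℂ), by fun_prop⟩, ?_⟩,
    ⟨⟨h, hcont⟩, squeeze_zero_norm hn hsl⟩, ?_, ?_⟩
  · simpa [Function.comp_def] using (Complex.continuous_ofReal.tendsto 0).comp hsl
  · ext x
    show f x = (((√‖f x‖ : ℝ) : ℂ) • (1 : B)) * (((√‖f x‖ : ℝ) : ℂ)⁻¹ • f x)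
    rw [smul_mul_assoc, one_mul, smul_smul]
    by_cases hx : f x = 0
    · simp [hx]
    · rw [mul_inv_cancel₀, one_smul]
      simpa [Real.sqrt_eq_zero'] using hx
  · intro y hy
    show ((√‖f y‖ : ℝ) : ℂ) = 0
    simp [hy]

open Filter Topology in
theorem auxMap [Nontrivial B] [Algebra.IsCentral ℂ B] (Φ : C₀(X, B) → C₀(X, B))
    (hΦ : IsAlgebraAutomorphism Φ) :
    ∃ φ : X → X, Continuous φ ∧ ∀ f x, f (φ x) = 0 → Φ f x = 0 := by
  obtain ⟨hlin, hmul, hbij⟩ := hΦ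
  have hscal : ∀ x (g : C₀(X, ℂ)), ∃ c : ℂ, algebraMap ℂ B c = Φ (auxJ g 1) x := by
    intro x g
    have hmem : Φ (auxJ g 1) x ∈ Subalgebra.center ℂ B := by
      rw [Subalgebra.mem_center_iff]
      intro A
      obtain ⟨k, hk, -⟩ := auxBump x Set.univ isOpen_univ trivial
      have hk := hk.self_of_nhds
      obtain ⟨f, hf⟩ := hbij.2 (auxJ k A)
      have hcomm : f * auxJ g 1 = auxJ g 1 * f := by
        ext z
        simp
      have := congrArg (fun u => (Φ u) x) hcomm
      simpa [hmul, hf, hk] using this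
    rw [Algebra.IsCentral.center_eq_bot, Algebra.mem_bot] at hmem
    exact hmem
  choose c hc using hscal
  have hinj : Function.Injective (algebraMap ℂ B) := (algebraMap ℂ B).injective
  have hJadd : ∀ g k : C₀(X, ℂ), auxJ (g + k) (1 : B) = auxJ g 1 + auxJ k 1 := by
    intro g k; ext z; simp [add_smul]
  have hJmul : ∀ g k : C₀(X, ℂ), auxJ (g * k) (1 : B) = auxJ g 1 * auxJ k 1 := by
    intro g k; ext z
    show (g z * k z) • (1 : B) = (g z • 1) * (k z • 1)
    rw [smul_mul_smul_comm, one_mul]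
  have hJsmul : ∀ (r : ℂ) (k : C₀(X, ℂ)), auxJ (r • k) (1 : B) = r • auxJ k 1 := by
    intro r k; ext z
    show (r * k z) • (1 : B) = r • k z • (1 : B)
    rw [mul_smul]
  have hpt : ∀ x, ∃ y, ∀ g, c x g = g y := by
    intro x
    let χ : C₀(X, ℂ) →ₙₐ[ℂ] ℂ :=
      { toFun := c x
        map_add' := fun g k => hinj (by simp [hc, hJadd, hlin.map_add])
        map_mul' := fun g k => hinj (by simp [hc, hJmul, hmul])
        map_zero' := hinj (by
          have h0 : auxJ (0 : C₀(X, ℂ)) (1 : B) = 0 := by ext z; simp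
          simp [hc, h0, hlin.map_zero])
        map_smul' := fun r k => hinj (by
          rw [hc, hJsmul, hlin.map_smul]
          simp [hc, Algebra.smul_def]) }
    refine auxChar χ ?_
    obtain ⟨k, hk, -⟩ := auxBump x Set.univ isOpen_univ trivial
    have hk := hk.self_of_nhds
    obtain ⟨f, hf⟩ := hbij.2 (auxJ k 1)
    obtain ⟨g, h, hgh, -⟩ := auxFactor f
    refine ⟨g, fun h0 => ?_⟩
    have h0 : c x g = 0 := h0
    have h1 := hc x g
    rw [h0, map_zero] at h1
    have h2 : Φ f x = 1 := by rw [hf]; simp [hk]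
    rw [hgh, hmul, ZeroAtInftyContinuousMap.mul_apply, ← h1, zero_mul] at h2
    exact zero_ne_one h2
  choose φ hφ using hpt
  refine ⟨φ, ?_, ?_⟩
  · rw [continuous_iff_continuousAt]
    intro x U hU
    obtain ⟨V, hVU, hV, hxV⟩ := mem_nhds_iff.1 hU
    obtain ⟨g, hg, hg0⟩ := auxBump (φ x) V hV hxV
    have hg := hg.self_of_nhds
    have hne : Φ (auxJ g 1) x ≠ 0 := by
      rw [← hc, hφ, hg]; simp
    have := (Φ (auxJ g 1)).continuous.continuousAt.eventually_ne hne
    refine mem_map.2 (mem_of_superset this ?_)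
    intro z hz
    by_contra hzU
    apply hz
    show Φ (auxJ g 1) z = 0
    rw [← hc, hφ, hg0 _ (fun h => hzU (hVU h)), map_zero]
  · intro f x hfx
    obtain ⟨g, h, hgh, hg⟩ := auxFactor f
    rw [hgh, hmul, ZeroAtInftyContinuousMap.mul_apply, ← hc, hφ, hg _ hfx, map_zero, zero_mul]

open Filter Topology in
theorem auxTau (Φ : C₀(X, B) → C₀(X, B)) (hΦ : IsAlgebraAutomorphism Φ)
    (φ : X → X) (hφc : Continuous φ) (hφ : ∀ f x, f (φ x) = 0 → Φ f x = 0) :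
    ∃ τ : X → B → B, (∀ x, IsLinearMap ℂ (τ x)) ∧ (∀ x A C, τ x (A * C) = τ x A * τ x C) ∧
      (∀ A, Continuous fun x => τ x A) ∧ ∀ f x, Φ f x = τ x (f (φ x)) := by
  obtain ⟨hlin, hmul, hbij⟩ := hΦ
  have hev : ∀ f k x, f (φ x) = k (φ x) → Φ f x = Φ k x := by
    intro f k x h
    have := hφ (f - k) x (by simp [h])
    rw [hlin.map_sub] at this
    simpa [sub_eq_zero] using this
  choose b hb _hb using fun x : X => auxBump x Set.univ isOpen_univ trivial
  have hb1 : ∀ x, b x x = 1 := fun x => (hb x).self_of_nhds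
  let τ : X → B → B := fun x A => Φ (auxJ (b (φ x)) A) x
  have hτ : ∀ f x, Φ f x = τ x (f (φ x)) := by
    intro f x
    exact hev _ _ _ (by simp [hb1])
  refine ⟨τ, ?_, ?_, ?_, hτ⟩
  · intro x
    constructor
    · intro A C
      have : auxJ (b (φ x)) (A + C) = auxJ (b (φ x)) A + auxJ (b (φ x)) C := by
        ext z; simp
      simp [τ, this, hlin.map_add]
    · intro r A
      have : auxJ (b (φ x)) (r • A) = r • auxJ (b (φ x)) A := by
        ext z
        exact smul_comm _ _ _
      simp [τ, this, hlin.map_smul]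
  · intro x A C
    show Φ _ x = Φ _ x * Φ _ x
    rw [← ZeroAtInftyContinuousMap.mul_apply, ← hmul]
    exact hev _ _ _ (by simp [hb1])
  · intro A
    rw [continuous_iff_continuousAt]
    intro x
    have h1 : ∀ᶠ z in 𝓝 x, b (φ x) (φ z) = 1 := hφc.continuousAt.eventually (hb (φ x))
    refine ((Φ (auxJ (b (φ x)) A)).continuous.continuousAt (x := x)).congr ?_
    filter_upwards [h1] with z hz
    show Φ (auxJ (b (φ x)) A) z = τ z A
    rw [hτ]
    simp [hz]

theorem auxMain [Nontrivial B] [Algebra.IsCentral ℂ B] (Φ : C₀(X, B) → C₀(X, B))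
    (hΦ : IsAlgebraAutomorphism Φ) :
    ∃ (τ σ : X → B → B) (φ : X ≃ₜ X),
      (∀ x : X, IsAlgebraAutomorphism (τ x)) ∧
      (∀ x : X, Function.LeftInverse (σ x) (τ x) ∧ Function.RightInverse (σ x) (τ x)) ∧
      (∀ A : B, Continuous fun x : X => τ x A) ∧
      (∀ A : B, Continuous fun x : X => σ x A) ∧
      ∀ (f : C₀(X, B)) (x : X), Φ f x = τ x (f (φ x)) := by
  obtain ⟨Ψ, hΨΦ, hΦΨ⟩ := Function.bijective_iff_has_inverse.1 hΦ.2.2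
  have hΨ : IsAlgebraAutomorphism Ψ := by
    obtain ⟨hlin, hmul, hbij⟩ := hΦ
    refine ⟨⟨fun a b => hbij.1 ?_, fun a b => hbij.1 ?_⟩, fun a b => hbij.1 ?_,
      Function.bijective_iff_has_inverse.2 ⟨Φ, hΦΨ, hΨΦ⟩⟩
    · rw [hlin.map_add, hΦΨ, hΦΨ, hΦΨ]
    · rw [hlin.map_smul, hΦΨ, hΦΨ]
    · rw [hmul, hΦΨ, hΦΨ, hΦΨ]
  have hinv : ∀ (Φ Ψ : C₀(X, B) → C₀(X, B)) (_ : ∀ f, Φ (Ψ f) = f) (φ ψ : X → X)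
      (_ : ∀ f x, f (φ x) = 0 → Φ f x = 0) (_ : ∀ f x, f (ψ x) = 0 → Ψ f x = 0) (x : X),
      ψ (φ x) = x := by
    intro Φ Ψ h φ ψ hφ hψ x
    by_contra hne
    obtain ⟨g, hg, hg0⟩ := auxBump x {ψ (φ x)}ᶜ isOpen_compl_singleton
      (by simpa using Ne.symm hne)
    have hg := hg.self_of_nhds
    have h1 := hφ _ _ (hψ (auxJ g 1) (φ x) (by simp [hg0]))
    rw [h] at h1
    simp [hg] at h1
  obtain ⟨φ, hφc, hφ⟩ := auxMap Φ hΦ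
  obtain ⟨ψ, hψc, hψ⟩ := auxMap Ψ hΨ
  have hψφ := hinv Φ Ψ hΦΨ φ ψ hφ hψ
  have hφψ := hinv Ψ Φ hΨΦ ψ φ hψ hφ
  obtain ⟨τ, hτ1, hτ2, hτ3, hτ4⟩ := auxTau Φ hΦ φ hφc hφ
  obtain ⟨σ, hσ1, hσ2, hσ3, hσ4⟩ := auxTau Ψ hΨ ψ hψc hψ
  have hL : ∀ x A, σ (φ x) (τ x A) = A := by
    intro x A
    obtain ⟨g, hg, -⟩ := auxBump (φ x) Set.univ isOpen_univ trivial
    have hg := hg.self_of_nhds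
    have h1 := hσ4 (Φ (auxJ g A)) (φ x)
    rw [hΨΦ, hψφ, hτ4] at h1
    simpa [hg] using h1.symm
  have hR : ∀ x A, τ x (σ (φ x) A) = A := by
    intro x A
    obtain ⟨g, hg, -⟩ := auxBump x Set.univ isOpen_univ trivial
    have hg := hg.self_of_nhds
    have h1 := hτ4 (Ψ (auxJ g A)) x
    rw [hΦΨ, hσ4, hψφ] at h1
    simpa [hg] using h1.symm
  refine ⟨τ, fun x => σ (φ x), ⟨⟨φ, ψ, hψφ, hφψ⟩, hφc, hψc⟩, ?_, ?_, hτ3, ?_, hτ4⟩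
  · exact fun x => ⟨hτ1 x, hτ2 x, Function.bijective_iff_has_inverse.2 ⟨σ (φ x), hL x, hR x⟩⟩
  · exact fun x => ⟨hL x, hR x⟩
  · exact fun A => (hσ3 A).comp hφc

end generic

/-- Every automorphism `Φ` of `C₀(X, B(H))` is of the form
`Φ(f)(x) = τ(x)(f(φ(x)))` where each `τ(x)` is an automorphism of `B(H)`, the maps
`x ↦ τ(x)` and `x ↦ τ(x)⁻¹` are strongly continuous, and `φ` is a homeomorphism of `X`. -/
theorem automorphism_of_C0_BH_form
    {H : Type*} [NormedAddCommGroup H] [InnerProductSpace ℂ H] [CompleteSpace H]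
    [TopologicalSpace.SeparableSpace H] (hH : ¬ FiniteDimensional ℂ H)
    {X : Type*} [TopologicalSpace X] [LocallyCompactSpace X] [T2Space X]
    (Φ : C₀(X, H →L[ℂ] H) → C₀(X, H →L[ℂ] H))
    (hΦ : IsAlgebraAutomorphism Φ) :
    ∃ (τ σ : X → (H →L[ℂ] H) → (H →L[ℂ] H)) (φ : X ≃ₜ X),
      (∀ x : X, IsAlgebraAutomorphism (τ x)) ∧
      (∀ x : X, Function.LeftInverse (σ x) (τ x) ∧ Function.RightInverse (σ x) (τ x)) ∧
      (∀ A : H →L[ℂ] H, Continuous fun x : X => τ x A) ∧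
      (∀ A : H →L[ℂ] H, Continuous fun x : X => σ x A) ∧
      ∀ (f : C₀(X, H →L[ℂ] H)) (x : X), Φ f x = τ x (f (φ x)) := by
  have hnt : Nontrivial H := by
    by_contra h
    rw [not_nontrivial_iff_subsingleton] at h
    exact hH inferInstance
  exact auxMain Φ hΦ
end

section
/- Let X be a locally compact Hausdorff space, let τ : X → Aut(B(H)) be any function and let φ : X → X be a bijection. If the linear map Φ defined by Φ(f)(x) = [τ(x)](f(φ(x))) (f ∈ C₀(X, B(H)), x ∈ X) maps C₀(X, B(H)) into C₀(X, B(H)), then Φ is an automorphism of C₀(X, B(H)), i.e., a multiplicative linear bijection of C₀(X, B(H)) onto itself. -/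
open scoped ZeroAtInfty

open Filter Topology

section Helpers

variable {H : Type*} [NormedAddCommGroup H] [InnerProductSpace ℂ H] [CompleteSpace H]

/-- Eidelheit: every automorphism of `B(H)` is spatial (no continuity assumed). -/
lemma exists_spatial [Nontrivial H] (τ : (H →L[ℂ] H) → (H →L[ℂ] H))
    (hτ : IsAlgebraAutomorphism τ) :
    ∃ U : H ≃L[ℂ] H, ∀ A x, U (A x) = τ A (U x) := by
  obtain ⟨hlin, hmul, hbij⟩ := hτ
  obtain ⟨u, hu⟩ := exists_ne (0 : H)
  obtain ⟨v, huv⟩ := SeparatingDual.exists_eq_one (R := ℂ) hu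
  have h0 : τ 0 = 0 := hlin.map_zero
  have hne : τ (v.smulRight u) ≠ 0 := by
    rw [← h0]
    intro h
    have := congrArg (fun B : H →L[ℂ] H => B u) (hbij.1 h)
    simp [huv] at this
    exact hu this
  obtain ⟨z, hz⟩ : ∃ z, τ (v.smulRight u) z ≠ 0 := by
    by_contra! h
    exact hne (ContinuousLinearMap.ext h)
  let T : H →ₗ[ℂ] H :=
    { toFun := fun x => τ (v.smulRight x) z
      map_add' := fun x y => by
        have : v.smulRight (x + y) = v.smulRight x + v.smulRight y := by ext; simp
        rw [this, hlin.map_add]; rfl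
      map_smul' := fun c x => by
        have : v.smulRight (c • x) = c • v.smulRight x := by
          ext w; simp [smul_smul, mul_comm]
        rw [this, hlin.map_smul]; rfl }
  have hT : ∀ x, T x = τ (v.smulRight x) z := fun x => rfl
  have key : ∀ A x, T (A x) = τ A (T x) := by
    intro A x
    have : v.smulRight (A x) = A * v.smulRight x := by ext w; simp
    rw [hT, this, hmul]; rfl
  obtain ⟨d, hd⟩ := SeparatingDual.exists_eq_one (R := ℂ) hz
  have surj : Function.Surjective T := by
    intro w
    obtain ⟨B, hB⟩ := hbij.2 (d.smulRight w)
    refine ⟨B u, ?_⟩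
    rw [key, hB, hT]; simp [hd]
  have inj0 : ∀ w, (∀ f : StrongDual ℂ H, T (f.smulRight u w) = 0) → w = 0 := by
    intro w hw
    by_contra hne
    obtain ⟨f, hf⟩ := SeparatingDual.exists_eq_one (R := ℂ) hne
    have := hw f
    rw [ContinuousLinearMap.smulRight_apply, hf, one_smul] at this
    exact hz this
  have inj : Function.Injective T := by
    rw [← LinearMap.ker_eq_bot, LinearMap.ker_eq_bot']
    intro w hw
    exact inj0 w fun f => by rw [key, hw, map_zero]
  have hcont : Continuous T := by
    refine T.continuous_of_seq_closed_graph fun s x y hs hTs => ?_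
    obtain ⟨w, rfl⟩ := surj y
    rw [← sub_eq_zero, ← map_sub]
    suffices w - x = 0 by rw [this, map_zero]
    refine inj0 _ fun f => ?_
    have h1 : Tendsto (fun n => τ (f.smulRight u) (T (s n))) atTop
        (𝓝 (τ (f.smulRight u) (T w))) :=
      ((τ (f.smulRight u)).continuous.tendsto _).comp hTs
    have h2 : Tendsto (fun n => f (s n) • T u) atTop (𝓝 (f x • T u)) :=
      (((f.continuous.tendsto _).comp hs)).smul_const _
    have h3 : (fun n => τ (f.smulRight u) (T (s n))) = fun n => f (s n) • T u := by
      funext n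
      rw [← key, ContinuousLinearMap.smulRight_apply, map_smul]
    rw [h3, ← key, ContinuousLinearMap.smulRight_apply, map_smul] at h1
    have := tendsto_nhds_unique h1 h2
    rw [ContinuousLinearMap.smulRight_apply, map_smul, map_sub, sub_smul, this, sub_self]
  let TL : H →L[ℂ] H := ⟨T, hcont⟩
  refine ⟨ContinuousLinearEquiv.ofBijective TL ?_ ?_, fun A x => ?_⟩
  · exact LinearMap.ker_eq_bot.2 inj
  · exact LinearMap.range_eq_top.2 surj
  · exact key A x

lemma auto_continuous [Nontrivial H] (τ : (H →L[ℂ] H) → (H →L[ℂ] H))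
    (hτ : IsAlgebraAutomorphism τ) : Continuous τ := by
  obtain ⟨U, hU⟩ := exists_spatial τ hτ
  have : τ = U.conjContinuousAlgEquiv := by
    funext A
    ext x
    have := hU A (U.symm x)
    simpa using this.symm
  rw [this]
  exact U.conjContinuousAlgEquiv.continuous

lemma auto_one [Nontrivial H] (τ : (H →L[ℂ] H) → (H →L[ℂ] H))
    (hτ : IsAlgebraAutomorphism τ) : τ 1 = 1 := by
  obtain ⟨B, hB⟩ := hτ.2.2.2 1
  have := hτ.2.1 1 B
  rw [one_mul, hB, mul_one] at this
  exact this.symm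

lemma auto_inv_bound [Nontrivial H] (τ : (H →L[ℂ] H) → (H →L[ℂ] H))
    (hτ : IsAlgebraAutomorphism τ) (M : ℝ) (hM0 : 0 ≤ M) (hM : ∀ A, ‖τ A‖ ≤ M * ‖A‖)
    (A : H →L[ℂ] H) : ‖A‖ ≤ M * ‖τ A‖ := by
  obtain ⟨U, hU⟩ := exists_spatial τ hτ
  refine A.opNorm_le_bound (by positivity) fun x => ?_
  by_cases hx : x = 0
  · simp [hx]
  obtain ⟨f, hf1, hf2⟩ := exists_dual_vector'' ℂ (A x)
  have hUx : 0 < ‖U x‖ := by simpa using hx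
  have e : τ (f.smulRight x) (τ A (U x)) = (‖A x‖ : ℂ) • U x := by
    rw [← hU, ← hU, ContinuousLinearMap.smulRight_apply, map_smul, hf2]; rfl
  have hn := congrArg norm e
  rw [norm_smul, Complex.norm_real, norm_norm] at hn
  have hs : ‖f.smulRight x‖ ≤ ‖x‖ := by
    rw [ContinuousLinearMap.norm_smulRight_apply]
    exact mul_le_of_le_one_left (norm_nonneg _) hf1
  have : ‖A x‖ * ‖U x‖ ≤ (M * ‖τ A‖ * ‖x‖) * ‖U x‖ := by
    rw [← hn]
    calc _ ≤ ‖τ (f.smulRight x)‖ * ‖τ A (U x)‖ := ContinuousLinearMap.le_opNorm _ _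
      _ ≤ (M * ‖x‖) * (‖τ A‖ * ‖U x‖) := by
        gcongr
        · exact (hM _).trans (by gcongr)
        · exact ContinuousLinearMap.le_opNorm _ _
      _ = _ := by ring
  exact le_of_mul_le_mul_right this hUx

lemma exists_bump {X : Type*} [TopologicalSpace X] [LocallyCompactSpace X] [T2Space X]
    {s t : Set X} (hs : IsCompact s) (ht : IsClosed t) (hd : Disjoint s t) (A : H →L[ℂ] H) :
    ∃ f : C₀(X, H →L[ℂ] H), (∀ x ∈ s, f x = A) ∧ (∀ x ∈ t, f x = 0) ∧ ∀ x, ‖f x‖ ≤ ‖A‖ := by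
  obtain ⟨h, h1, h0, hc, hI⟩ := exists_continuous_one_zero_of_isCompact hs ht hd
  have hc' : HasCompactSupport fun x => (h x : ℂ) • A := by
    refine hc.mono' ?_
    refine subset_trans ?_ subset_closure
    intro x hx hx0
    apply hx
    simp [hx0]
  refine ⟨⟨⟨fun x => (h x : ℂ) • A, by fun_prop⟩, hc'.is_zero_at_infty⟩, ?_, ?_, ?_⟩
  · intro x hx
    change (h x : ℂ) • A = A
    rw [h1 hx]; simp
  · intro x hx
    change (h x : ℂ) • A = 0
    rw [h0 hx]; simp
  · intro x
    change ‖(h x : ℂ) • A‖ ≤ ‖A‖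
    rw [norm_smul, Complex.norm_real, Real.norm_of_nonneg (hI x).1]
    exact mul_le_of_le_one_left (norm_nonneg _) (hI x).2

end Helpers

/-- If `τ : X → Aut(B(H))`, `φ : X → X` is a bijection, and the map
`f ↦ (x ↦ τ(x)(f(φ(x))))` maps `C₀(X, B(H))` into itself (encoded by the existence of
`Φ` on `C₀(X, B(H))` given pointwise by this formula), then `Φ` is an automorphism. -/
theorem form_is_automorphism_of_C0_BH
    {H : Type*} [NormedAddCommGroup H] [InnerProductSpace ℂ H] [CompleteSpace H]
    [TopologicalSpace.SeparableSpace H] (hH : ¬ FiniteDimensional ℂ H)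
    {X : Type*} [TopologicalSpace X] [LocallyCompactSpace X] [T2Space X]
    (τ : X → (H →L[ℂ] H) → (H →L[ℂ] H)) (hτ : ∀ x : X, IsAlgebraAutomorphism (τ x))
    (φ : X → X) (hφ : Function.Bijective φ)
    (Φ : C₀(X, H →L[ℂ] H) → C₀(X, H →L[ℂ] H))
    (hΦ : ∀ (f : C₀(X, H →L[ℂ] H)) (x : X), Φ f x = τ x (f (φ x))) :
    IsAlgebraAutomorphism Φ := by
  have hlin : IsLinearMap ℂ Φ :=
    ⟨fun f g => by ext1 x; simp only [ZeroAtInftyContinuousMap.add_apply, hΦ, (hτ x).1.map_add],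
     fun c f => by ext1 x; simp only [ZeroAtInftyContinuousMap.smul_apply, hΦ, (hτ x).1.map_smul]⟩
  have hmul : ∀ a b, Φ (a * b) = Φ a * Φ b := fun a b => by
    ext1 x; simp only [ZeroAtInftyContinuousMap.mul_apply, hΦ, (hτ x).2.1]
  have hinj : Function.Injective Φ := by
    intro f g hfg
    ext1 y
    obtain ⟨x, rfl⟩ := hφ.2 y
    apply (hτ x).2.2.1
    rw [← hΦ, ← hΦ, hfg]
  refine ⟨hlin, hmul, hinj, ?_⟩
  have hnt : Nontrivial H := by
    by_contra h
    rw [not_nontrivial_iff_subsingleton] at h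
    exact hH inferInstance
  have heval : ∀ x : X, Continuous fun f : C₀(X, H →L[ℂ] H) => f x := fun x =>
    continuous_iff_continuousAt.2 fun f =>
      (ZeroAtInftyContinuousMap.tendsto_iff_tendstoUniformly.1 tendsto_id).tendsto_at x
  have hΦc : Continuous Φ := by
    refine (IsLinearMap.mk' Φ hlin).continuous_of_seq_closed_graph fun s f g hs hg => ?_
    ext1 x
    have h1 := ((heval x).tendsto _).comp hg
    have h2 := ((((auto_continuous _ (hτ x)).comp (heval (φ x))).tendsto _).comp hs)
    refine tendsto_nhds_unique h1 ?_
    have e : (IsLinearMap.mk' Φ hlin f) x = τ x (f (φ x)) := hΦ f x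
    rw [e]
    refine h2.congr fun n => ?_
    exact (hΦ (s n) x).symm
  let ΦL : C₀(X, H →L[ℂ] H) →L[ℂ] C₀(X, H →L[ℂ] H) := ⟨IsLinearMap.mk' Φ hlin, hΦc⟩
  have hnorm : ∀ (f : C₀(X, H →L[ℂ] H)) x, ‖f x‖ ≤ ‖f‖ := fun f x => f.toBCF.norm_coe_le_norm x
  obtain ⟨M, hM0, hM⟩ : ∃ M : ℝ, 0 ≤ M ∧ ∀ x A, ‖τ x A‖ ≤ M * ‖A‖ := by
    refine ⟨‖ΦL‖, ΦL.opNorm_nonneg, fun x A => ?_⟩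
    obtain ⟨f, hf1, -, hf⟩ := exists_bump (isCompact_singleton (x := φ x)) isClosed_empty
      (Set.disjoint_empty _) A
    have hfn : ‖f‖ ≤ ‖A‖ := (BoundedContinuousFunction.norm_le (f := f.toBCF) (norm_nonneg _)).2 hf
    have e : (ΦL f) x = τ x A := by
      rw [← hf1 (φ x) rfl]; exact hΦ f x
    rw [← e]
    exact (hnorm _ x).trans ((ΦL.le_opNorm f).trans (by gcongr))
  have hinv : ∀ x A, ‖A‖ ≤ M * ‖τ x A‖ := fun x A => auto_inv_bound (τ x) (hτ x) M hM0 (hM x) A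
  have hφc : Continuous φ := by
    refine continuous_iff_continuousAt.2 fun x0 => ?_
    intro U hU
    obtain ⟨V, hVU, hVo, hxV⟩ := mem_nhds_iff.1 hU
    obtain ⟨f, hf1, hf0, -⟩ := exists_bump (H := H) (isCompact_singleton (x := φ x0))
      hVo.isClosed_compl (by simpa using hxV) 1
    have h1 : Φ f x0 ≠ 0 := by
      rw [hΦ, hf1 _ rfl, auto_one _ (hτ x0)]
      exact one_ne_zero
    have h2 : ∀ᶠ x in 𝓝 x0, Φ f x ≠ 0 :=
      (map_continuous (Φ f)).continuousAt.eventually_ne h1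
    change ∀ᶠ x in 𝓝 x0, φ x ∈ U
    filter_upwards [h2] with x hx
    apply hVU
    by_contra hxV
    apply hx
    rw [hΦ, hf0 _ hxV, (hτ x).1.map_zero]
  have hφt : Tendsto φ (cocompact X) (cocompact X) := by
    refine (hasBasis_cocompact.tendsto_right_iff).2 fun K hK => ?_
    obtain ⟨f, hf1, -, -⟩ := exists_bump (H := H) hK isClosed_empty (Set.disjoint_empty _) 1
    have h2 : ∀ᶠ x in cocompact X, Φ f x ≠ 1 :=
      (zero_at_infty (Φ f)).eventually_ne zero_ne_one
    filter_upwards [h2] with x hx hxK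
    apply hx
    rw [hΦ, hf1 _ hxK, auto_one _ (hτ x)]
  have hproper : IsProperMap φ := isProperMap_iff_tendsto_cocompact.2 ⟨hφc, hφt⟩
  let e : X ≃ₜ X := (Equiv.ofBijective φ hφ).toHomeomorphOfContinuousClosed hφc hproper.isClosedMap
  have he : ∀ x, e x = φ x := fun x => rfl
  have hτc : ∀ A, Continuous fun x => τ x A := by
    intro A
    refine continuous_iff_continuousAt.2 fun x0 => ?_
    obtain ⟨K, hK, hK0⟩ := exists_compact_mem_nhds (φ x0)
    obtain ⟨f, hf1, -, -⟩ := exists_bump (H := H) hK isClosed_empty (Set.disjoint_empty _) A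
    refine (map_continuous (Φ f)).continuousAt.congr ?_
    filter_upwards [hφc.continuousAt hK0] with x hx
    rw [hΦ, hf1 _ hx]
  intro g
  choose k hk using fun x => (hτ x).2.2.2 (g x)
  have hkc : Continuous k := by
    refine continuous_iff_continuousAt.2 fun x0 => ?_
    have hlim : Tendsto (fun x => M * ‖g x - τ x (k x0)‖) (𝓝 x0) (𝓝 0) := by
      have : Continuous fun x => M * ‖g x - τ x (k x0)‖ :=
        continuous_const.mul ((map_continuous g).sub (hτc _)).norm
      have h := this.tendsto x0
      simpa [hk] using h
    refine tendsto_iff_norm_sub_tendsto_zero.2 (squeeze_zero (fun _ => norm_nonneg _) (fun x => ?_) hlim)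
    rw [← hk x, ← (hτ x).1.map_sub]
    exact hinv x _
  have hk0 : Tendsto k (cocompact X) (𝓝 0) := by
    have h := ((zero_at_infty g).norm).const_mul M
    rw [norm_zero, mul_zero] at h
    refine squeeze_zero_norm (fun x => ?_) h
    rw [← hk x]
    exact hinv x _
  refine ⟨⟨⟨k ∘ e.symm, hkc.comp e.symm.continuous⟩,
    hk0.comp e.symm.isClosedEmbedding.tendsto_cocompact⟩, ?_⟩
  ext1 x
  rw [hΦ, ← hk x]
  change τ x (k (e.symm (e x))) = _
  rw [e.symm_apply_apply]
end

section
/- Let X be a locally compact Hausdorff space and let Φ be a surjective linear isometry of C₀(X, B(H)) onto itself. Then there exist a function τ : X → Iso(B(H)) and a bijection φ : X → X such that Φ(f)(x) = [τ(x)](f(φ(x))) for every f ∈ C₀(X, B(H)) and every x ∈ X; moreover, the maps x ↦ τ(x) and x ↦ τ(x)⁻¹ are strongly continuous (i.e., x ↦ [τ(x)](A) and x ↦ [τ(x)⁻¹](A) are norm-continuous for every A ∈ B(H)) and φ is a homeomorphism of X. -/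
open scoped ZeroAtInfty

/-- A surjective linear isometry of a normed space onto itself. -/
def IsSurjectiveLinearIsometry {A : Type*} [SeminormedAddCommGroup A] [Module ℂ A]
    (Φ : A → A) : Prop :=
  IsLinearMap ℂ Φ ∧ Function.Surjective Φ ∧ ∀ a : A, ‖Φ a‖ = ‖a‖

section helpers
open Filter Topology
variable {H : Type*} [NormedAddCommGroup H] [InnerProductSpace ℂ H]
variable {X : Type*} [TopologicalSpace X]

lemma c0bh_norm_est (u w : H) (hu : ‖u‖ = 1) (hw : ‖w‖ = 1) (B : H →L[ℂ] H)
    (hB : inner ℂ w (B u) = 0) (C : ℝ) (hC : ‖B‖ ≤ C) (R : ℝ) (hR : 0 ≤ R) :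
    ‖(R : ℂ) • InnerProductSpace.rankOne ℂ w u + B‖ ≤ Real.sqrt (R ^ 2 + 4 * C ^ 2) := by
  have hC0 : 0 ≤ C := (norm_nonneg _).trans hC
  refine ContinuousLinearMap.opNorm_le_bound _ (Real.sqrt_nonneg _) fun ξ => ?_
  set a : ℂ := inner ℂ u ξ with ha
  set η : H := ξ - a • u with hη
  have huu : inner ℂ u u = (1 : ℂ) := by
    rw [inner_self_eq_norm_sq_to_K, hu]; simp
  have hort : inner ℂ u η = 0 := by
    rw [hη, inner_sub_right, inner_smul_right, huu, ← ha]; simp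
  have hξ : ξ = a • u + η := by simp [hη]
  have hnξ : ‖ξ‖ * ‖ξ‖ = ‖a‖ ^ 2 + ‖η‖ ^ 2 := by
    rw [hξ, norm_add_sq_eq_norm_sq_add_norm_sq_of_inner_eq_zero (𝕜 := ℂ), norm_smul, hu]
    · ring
    · rw [inner_smul_left, hort, mul_zero]
  set v1 : H := ((R : ℂ) * a) • w + a • B u with hv1
  have hval : ((R : ℂ) • InnerProductSpace.rankOne ℂ w u + B) ξ = v1 + B η := by
    have : B ξ = a • B u + B η := by conv_lhs => rw [hξ]
                                     simp
    simp only [_root_.add_apply, _root_.smul_apply,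
      InnerProductSpace.rankOne_apply, this, hv1, ← ha, smul_smul]
    abel
  have hBu : ‖B u‖ ≤ C := by
    have := B.le_opNorm u
    rw [hu, mul_one] at this; exact this.trans hC
  have hBη : ‖B η‖ ≤ C * ‖η‖ := (B.le_opNorm η).trans (by gcongr)
  have hv1n : ‖v1‖ * ‖v1‖ = (R * ‖a‖) ^ 2 + ‖a‖ ^ 2 * ‖B u‖ ^ 2 := by
    rw [hv1, norm_add_sq_eq_norm_sq_add_norm_sq_of_inner_eq_zero (𝕜 := ℂ)]
    · simp only [norm_smul, norm_mul, hw, Complex.norm_real, Real.norm_eq_abs, abs_of_nonneg hR]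
      ring
    · rw [inner_smul_left, inner_smul_right, hB]; simp
  have hv1le : ‖v1‖ ≤ (R + C) * ‖a‖ := by
    refine (norm_add_le _ _).trans ?_
    simp only [norm_smul, norm_mul, hw, Complex.norm_real, Real.norm_eq_abs, abs_of_nonneg hR]
    nlinarith [norm_nonneg a]
  rw [hval]
  have key : ‖v1 + B η‖ ^ 2 ≤ (R ^ 2 + 4 * C ^ 2) * (‖ξ‖ * ‖ξ‖) := by
    have h1 : ‖v1 + B η‖ ^ 2 ≤ (‖v1‖ + ‖B η‖) ^ 2 := by
      gcongr; exact norm_add_le _ _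
    have h2 : ‖v1‖ * ‖B η‖ ≤ ((R + C) * ‖a‖) * (C * ‖η‖) := by gcongr
    have h3 : ‖B η‖ ^ 2 ≤ (C * ‖η‖) ^ 2 := by gcongr
    have h4 : ‖B u‖ ^ 2 ≤ C ^ 2 := by gcongr
    have h5 : ‖a‖ ^ 2 * ‖B u‖ ^ 2 ≤ ‖a‖ ^ 2 * C ^ 2 := by gcongr
    rw [hnξ]
    have h6 := sq_nonneg (R * ‖η‖ - C * ‖a‖)
    have h7 := sq_nonneg (C * ‖η‖ - C * ‖a‖)
    have h8 := sq_nonneg (C * ‖η‖)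
    have h9 := sq_nonneg (C * ‖a‖)
    nlinarith
  calc ‖v1 + B η‖ = Real.sqrt (‖v1 + B η‖ ^ 2) := (Real.sqrt_sq (norm_nonneg _)).symm
    _ ≤ Real.sqrt ((R ^ 2 + 4 * C ^ 2) * (‖ξ‖ * ‖ξ‖)) := Real.sqrt_le_sqrt key
    _ = _ := by rw [Real.sqrt_mul (by positivity), Real.sqrt_mul_self (norm_nonneg _)]

lemma c0bh_scalar (S : (H →L[ℂ] H) →ₗ[ℂ] (H →L[ℂ] H))
    (hS : ∀ A u w, inner ℂ w (A u) = 0 → inner ℂ w (S A u) = 0) :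
    ∃ c : ℂ, ∀ A, S A = c • A := by
  have h1 : ∃ c : ℂ, (S (1 : H →L[ℂ] H) : H →ₗ[ℂ] H) = c • 1 := by
    apply LinearMap.exists_eq_smul_id_of_forall_notLinearIndependent
    intro u
    by_cases hu : u = 0
    · intro h; exact h.ne_zero 0 (by simpa using hu)
    have huu : inner ℂ u u ≠ 0 := by simpa using hu
    rw [LinearIndependent.pair_iff' hu]
    push Not
    set D := S (1 : H →L[ℂ] H)
    refine ⟨inner ℂ u (D u) / inner ℂ u u, ?_⟩
    set a : ℂ := inner ℂ u (D u) / inner ℂ u u with ha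
    set w := D u - a • u with hw
    have hwu : inner ℂ u w = 0 := by
      rw [hw, inner_sub_right, inner_smul_right, ha, div_mul_cancel₀ _ huu, sub_self]
    have hwu' : inner ℂ w u = 0 := by rw [← inner_conj_symm, hwu, map_zero]
    have h2 : inner ℂ w (D u) = 0 := hS 1 u w (by simpa using hwu')
    have h3 : inner ℂ w w = 0 := by
      conv_lhs => rw [hw]
      rw [← hw, inner_sub_right, inner_smul_right, h2, hwu']; simp
    have h4 : w = 0 := inner_self_eq_zero.mp h3
    exact (sub_eq_zero.mp h4).symm
  obtain ⟨c, hc⟩ := h1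
  refine ⟨c, fun A => ?_⟩
  have hc' : ∀ u, S 1 u = c • u := fun u => by
    have := LinearMap.congr_fun hc u
    simpa using this
  have h2 : ∀ u w : H, inner ℂ w u ≠ (0 : ℂ) → inner ℂ w ((S A - c • A) u) = 0 := by
    intro u w huw
    set t : ℂ := inner ℂ w (A u) / inner ℂ w u with ht
    have := hS (A - t • 1) u w (by
      simp [inner_sub_right, inner_smul_right, ht, div_mul_cancel₀ _ huw])
    have h5 : inner ℂ w (A u) = t * inner ℂ w u := by rw [ht, div_mul_cancel₀ _ huw]
    simp only [map_sub, map_smul, _root_.sub_apply, _root_.smul_apply,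
      hc', inner_sub_right, inner_smul_right] at this ⊢
    rw [h5]; linear_combination this
  rw [← sub_eq_zero]
  ext u
  simp only [_root_.zero_apply]
  by_cases hu : u = 0
  · simp [hu]
  refine ext_inner_left ℂ fun w => ?_
  rw [inner_zero_right]
  have huu : inner ℂ u u ≠ (0 : ℂ) := by simpa using hu
  by_cases huw : inner ℂ w u = (0 : ℂ)
  · have h3 := h2 u (w + u) (by rw [inner_add_left, huw, zero_add]; exact huu)
    rw [inner_add_left, h2 u u huu, add_zero] at h3
    exact h3
  · exact h2 u w huw

/-- multiplication by a scalar function on the one point compactification -/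
noncomputable def c0bhMul (h : C(OnePoint X, ℂ)) (f : C₀(X, H →L[ℂ] H)) : C₀(X, H →L[ℂ] H) where
  toFun x := h x • f x
  continuous_toFun := by
    have := OnePoint.continuous_coe (X := X)
    have := f.continuous
    fun_prop
  zero_at_infty' := by
    have h0 : Tendsto (fun x => ‖h‖ * ‖f x‖) (cocompact X) (𝓝 0) := by
      simpa using (f.zero_at_infty'.norm.const_mul ‖h‖)
    refine squeeze_zero_norm (fun x => ?_) h0
    rw [norm_smul]
    gcongr
    exact h.norm_coe_le_norm _

lemma c0bhMul_apply (h : C(OnePoint X, ℂ)) (f : C₀(X, H →L[ℂ] H)) (x : X) :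
    c0bhMul h f x = h x • f x := rfl

lemma c0bh_norm_apply_le (f : C₀(X, H →L[ℂ] H)) (x : X) : ‖f x‖ ≤ ‖f‖ := by
  rw [← ZeroAtInftyContinuousMap.norm_toBCF_eq_norm]
  exact f.toBCF.norm_coe_le_norm x

lemma c0bh_norm_le (f : C₀(X, H →L[ℂ] H)) {r : ℝ} (hr : 0 ≤ r) (h : ∀ x, ‖f x‖ ≤ r) :
    ‖f‖ ≤ r := by
  rw [← ZeroAtInftyContinuousMap.norm_toBCF_eq_norm]
  exact (BoundedContinuousFunction.norm_le hr).2 h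

variable [LocallyCompactSpace X] [T2Space X]

lemma c0bh_bump (x : X) (U : Set X) (hU : U ∈ 𝓝 x) : ∃ k : X → ℝ, (∀ᶠ y in 𝓝 x, k y = 1) ∧
    (∀ y, y ∉ U → k y = 0) ∧ (∀ y, 0 ≤ k y ∧ k y ≤ 1) ∧
    ∀ A : H →L[ℂ] H, ∃ g : C₀(X, H →L[ℂ] H), ∀ y, g y = (k y : ℂ) • A := by
  obtain ⟨K, hK, hKU, hKc⟩ := local_compact_nhds hU
  obtain ⟨V, hVU, hVo, hxV⟩ := mem_nhds_iff.1 hK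
  obtain ⟨K', hK', hKV', hKc'⟩ := local_compact_nhds (hVo.mem_nhds hxV)
  obtain ⟨k, h1, h0, hs, hI⟩ := exists_continuous_one_zero_of_isCompact hKc'
    hVo.isClosed_compl (Set.disjoint_compl_right_iff_subset.2 hKV')
  refine ⟨k, Filter.mem_of_superset hK' (fun y hy => h1 hy),
    fun y hy => h0 (fun hyV => hy (hKU (hVU hyV))), fun y => hI y, fun A => ?_⟩
  refine ⟨⟨⟨fun y => (k y : ℂ) • A, by fun_prop⟩, ?_⟩, fun y => rfl⟩
  have := hs.is_zero_at_infty
  have h2 : Tendsto (fun y => ((k y : ℝ) : ℂ) • A) (cocompact X) (𝓝 (((0 : ℝ) : ℂ) • A)) :=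
    ((Complex.continuous_ofReal.tendsto 0).comp this).smul_const A
  simpa using h2

lemma c0bh_local (T : C₀(X, H →L[ℂ] H) →ₗ[ℂ] C₀(X, H →L[ℂ] H)) (lam : ℝ) (hlam : 0 ≤ lam)
    (hT : ∀ (v g : C₀(X, H →L[ℂ] H)) (r : ℝ), (∀ ζ : ℂ, ‖ζ‖ ≤ lam → ‖g - ζ • v‖ ≤ r) →
      ‖g - T v‖ ≤ r) (x : X) (u w : H) (hu : ‖u‖ = 1) (hw : ‖w‖ = 1)
    (f : C₀(X, H →L[ℂ] H)) (hf : inner ℂ w (f x u) = 0) : inner ℂ w (T f x u) = 0 := by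
  by_contra hz
  set z : ℂ := inner ℂ w (T f x u) with hzdef
  obtain ⟨f', hf', d, hd, hTf'⟩ : ∃ f' : C₀(X, H →L[ℂ] H), inner ℂ w (f' x u) = 0 ∧ ∃ d : ℝ,
      0 < d ∧ inner ℂ w (T f' x u) = -(d : ℂ) := by
    refine ⟨(-(starRingEnd ℂ) z) • f, ?_, ‖z‖ ^ 2, by positivity, ?_⟩
    · rw [ZeroAtInftyContinuousMap.smul_apply, _root_.smul_apply, inner_smul_right, hf, mul_zero]
    · rw [map_smul, ZeroAtInftyContinuousMap.smul_apply, _root_.smul_apply, inner_smul_right,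
        ← hzdef]
      have := Complex.conj_mul' z
      push_cast
      linear_combination -this
  set C : ℝ := lam * ‖f' x‖ with hC
  set R : ℝ := lam * ‖f'‖ + 8 * C ^ 2 / d + 1 with hR
  have hR0 : 0 < R := by positivity
  set ε : ℝ := d / (2 * (lam + 1)) with hε
  have hε0 : 0 < ε := by positivity
  have hlε : lam * ε ≤ d / 2 := by
    rw [hε, mul_div_assoc', div_le_div_iff₀ (by positivity) (by positivity)]
    nlinarith
  have hU : {y | ‖f' y - f' x‖ < ε} ∈ 𝓝 x := by
    have h1 : Tendsto (fun y => ‖f' y - f' x‖) (𝓝 x) (𝓝 ‖f' x - f' x‖) :=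
      ((f'.continuous.sub continuous_const).norm).tendsto x
    rw [sub_self, norm_zero] at h1
    exact h1.eventually (gt_mem_nhds hε0)
  obtain ⟨k, hk1, hk0, hkI, hkg⟩ := c0bh_bump (H := H) x _ hU
  obtain ⟨g, hg⟩ := hkg ((R : ℂ) • InnerProductSpace.rankOne ℂ w u)
  have hsq : Real.sqrt (R ^ 2 + 4 * C ^ 2) ≤ R + d / 4 := by
    rw [Real.sqrt_le_left (by positivity)]
    have h1 : 8 * C ^ 2 / d ≤ R := by
      have : 0 ≤ lam * ‖f'‖ := by positivity
      linarith
    rw [div_le_iff₀ hd] at h1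
    nlinarith [sq_nonneg d]
  have hall : ∀ ζ : ℂ, ‖ζ‖ ≤ lam → ‖g - ζ • f'‖ ≤ R + 3 * d / 4 := by
    intro ζ hζ
    refine c0bh_norm_le _ (by positivity) fun y => ?_
    rw [ZeroAtInftyContinuousMap.sub_apply, ZeroAtInftyContinuousMap.smul_apply, hg]
    by_cases hy : ‖f' y - f' x‖ < ε
    · have h1 := c0bh_norm_est u w hu hw (-(ζ • f' x))
        (by simp [inner_smul_right, hf']) C
        (by rw [norm_neg, norm_smul, hC]; gcongr) (k y * R) (mul_nonneg (hkI y).1 hR0.le)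
      have h2 : Real.sqrt ((k y * R) ^ 2 + 4 * C ^ 2) ≤ Real.sqrt (R ^ 2 + 4 * C ^ 2) := by
        apply Real.sqrt_le_sqrt
        have : k y * R ≤ R := mul_le_of_le_one_left hR0.le (hkI y).2
        have h3 : 0 ≤ k y * R := mul_nonneg (hkI y).1 hR0.le
        gcongr
      have h4 : (k y : ℂ) • (R : ℂ) • InnerProductSpace.rankOne ℂ w u - ζ • f' y =
          ((k y * R : ℝ) : ℂ) • InnerProductSpace.rankOne ℂ w u + -(ζ • f' x)
            + - (ζ • (f' y - f' x)) := by
        rw [smul_smul, smul_sub]; push_cast; abel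
      rw [h4]
      refine (norm_add_le _ _).trans ?_
      have h5 : ‖-(ζ • (f' y - f' x))‖ ≤ lam * ε := by
        rw [norm_neg, norm_smul]; gcongr
      linarith
    · rw [hk0 y hy]
      simp only [Complex.ofReal_zero, zero_smul, zero_sub, norm_neg, norm_smul]
      have h1 : ‖ζ‖ * ‖f' y‖ ≤ lam * ‖f'‖ := by
        gcongr; exact c0bh_norm_apply_le f' y
      have : 0 ≤ 8 * C ^ 2 / d := by positivity
      linarith
  have hfin := (c0bh_norm_apply_le _ x).trans (hT f' g _ hall)
  rw [ZeroAtInftyContinuousMap.sub_apply, hg, hk1.self_of_nhds] at hfin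
  set Q := ((1 : ℝ) : ℂ) • (R : ℂ) • InnerProductSpace.rankOne ℂ w u - T f' x with hQ
  have huu : inner ℂ u u = (1 : ℂ) := by
    rw [inner_self_eq_norm_sq_to_K, hu]; simp
  have hww : inner ℂ w w = (1 : ℂ) := by
    rw [inner_self_eq_norm_sq_to_K, hw]; simp
  have hval : inner ℂ w (Q u) = ((R + d : ℝ) : ℂ) := by
    rw [hQ]
    simp only [_root_.sub_apply, _root_.smul_apply, InnerProductSpace.rankOne_apply,
      inner_sub_right, inner_smul_right, hTf', huu, hww]
    push_cast; ring
  have h1 : ‖inner ℂ w (Q u)‖ ≤ ‖Q‖ := by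
    refine (norm_inner_le_norm _ _).trans ?_
    rw [hw, one_mul]
    have := Q.le_opNorm u
    rwa [hu, mul_one] at this
  rw [hval, Complex.norm_real, Real.norm_eq_abs, abs_of_pos (by positivity)] at h1
  linarith

lemma c0bh_mult (T : C₀(X, H →L[ℂ] H) →ₗ[ℂ] C₀(X, H →L[ℂ] H)) (lam : ℝ) (hlam : 0 ≤ lam)
    (hT : ∀ (v g : C₀(X, H →L[ℂ] H)) (r : ℝ), (∀ ζ : ℂ, ‖ζ‖ ≤ lam → ‖g - ζ • v‖ ≤ r) →
      ‖g - T v‖ ≤ r) (x : X) : ∃ c : ℂ, ∀ f, T f x = c • f x := by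
  have hloc : ∀ (u w : H) (f : C₀(X, H →L[ℂ] H)), inner ℂ w (f x u) = 0 →
      inner ℂ w (T f x u) = 0 := by
    intro u w f hf
    by_cases hu : u = 0
    · simp [hu]
    by_cases hw : w = 0
    · simp [hw]
    have hu' : (‖u‖ : ℂ) ≠ 0 := by simpa using hu
    have hw' : (‖w‖ : ℂ) ≠ 0 := by simpa using hw
    have := c0bh_local T lam hlam hT x ((‖u‖⁻¹ : ℂ) • u) ((‖w‖⁻¹ : ℂ) • w)
      (by simp [norm_smul, hu]) (by simp [norm_smul, hw]) f
      (by rw [map_smul, inner_smul_right, inner_smul_left, hf]; simp)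
    rw [map_smul, inner_smul_right, inner_smul_left] at this
    simpa [hu, hw] using this
  obtain ⟨k, hk1, -, -, hkg⟩ := c0bh_bump (H := H) x _ univ_mem
  choose G hG using hkg
  have hk1 : k x = 1 := hk1.self_of_nhds
  let S : (H →L[ℂ] H) →ₗ[ℂ] (H →L[ℂ] H) :=
    { toFun := fun A => T (G A) x
      map_add' := fun A B => by
        have : G (A + B) = G A + G B := by
          refine ZeroAtInftyContinuousMap.ext fun y => ?_
          simp [hG]
        rw [this, map_add, ZeroAtInftyContinuousMap.add_apply]
      map_smul' := fun c A => by
        have : G (c • A) = c • G A := by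
          refine ZeroAtInftyContinuousMap.ext fun y => ?_
          rw [ZeroAtInftyContinuousMap.smul_apply, hG, hG, smul_comm]
        rw [this, map_smul, ZeroAtInftyContinuousMap.smul_apply]; rfl }
  obtain ⟨c, hc⟩ := c0bh_scalar S (fun A u w h => hloc u w (G A) (by rw [hG, hk1]; simpa using h))
  refine ⟨c, fun f => ?_⟩
  rw [← hc (f x)]
  change T f x = T (G (f x)) x
  rw [← sub_eq_zero, ← ZeroAtInftyContinuousMap.sub_apply, ← map_sub]
  ext u
  refine ext_inner_left ℂ fun w => ?_
  rw [hloc u w _ (by simp [hG, hk1])]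
  simp

lemma c0bh_ext (f : C₀(X, H →L[ℂ] H)) : ∃ F : C(OnePoint X, H →L[ℂ] H), F OnePoint.infty = 0 ∧
    ∀ x : X, F x = f x := by
  refine ⟨⟨fun q => OnePoint.elim q (0 : H →L[ℂ] H) (fun x => f x), ?_⟩, rfl, fun x => rfl⟩
  rw [OnePoint.continuous_iff]
  refine ⟨?_, f.continuous⟩
  rw [coclosedCompact_eq_cocompact]
  exact f.zero_at_infty'

lemma c0bh_map_sub (Φ : C₀(X, H →L[ℂ] H) ≃ₗᵢ[ℂ] C₀(X, H →L[ℂ] H)) (f g : C₀(X, H →L[ℂ] H)) :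
    Φ (f - g) = Φ f - Φ g := by
  have h : f - g = f + (-1 : ℂ) • g := by
    refine ZeroAtInftyContinuousMap.ext fun z => ?_
    simp [sub_eq_add_neg]
  have h' : Φ f - Φ g = Φ f + (-1 : ℂ) • Φ g := by
    refine ZeroAtInftyContinuousMap.ext fun z => ?_
    simp [sub_eq_add_neg]
  rw [h, h', map_add, map_smul]

lemma c0bh_char {K : Type*} [TopologicalSpace K] [CompactSpace K] [T2Space K]
    (ψ : C(K, ℂ) →ₐ[ℂ] ℂ) : ∃ p, ∀ h, ψ h = h p := by
  obtain ⟨p, hp⟩ := (WeakDual.CharacterSpace.continuousMapEval_bijective K ℂ).2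
    (WeakDual.CharacterSpace.equivAlgHom.symm ψ)
  refine ⟨p, fun h => ?_⟩
  rw [← WeakDual.CharacterSpace.equivAlgHom_symm_coe ψ, ← hp,
    WeakDual.CharacterSpace.continuousMapEval_apply_apply]

set_option maxHeartbeats 2000000 in
lemma c0bh_point [Nontrivial H] (Φ : C₀(X, H →L[ℂ] H) ≃ₗᵢ[ℂ] C₀(X, H →L[ℂ] H)) :
    ∃ φ : X → X, ∀ y f, f (φ y) = 0 → Φ f y = 0 := by
  suffices hs : ∀ y, ∃ x, ∀ f : C₀(X, H →L[ℂ] H), f x = 0 → Φ f y = 0 by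
    choose φ hφ using hs
    exact ⟨φ, hφ⟩
  intro y
  have hmul : ∀ h : C(OnePoint X, ℂ), ∃ c : ℂ, ∀ g, Φ (c0bhMul h g) y = c • Φ g y := by
    intro h
    let T : C₀(X, H →L[ℂ] H) →ₗ[ℂ] C₀(X, H →L[ℂ] H) :=
      { toFun := fun f => Φ (c0bhMul h (Φ.symm f))
        map_add' := fun a b => by
          rw [← map_add]
          congr 1
          refine ZeroAtInftyContinuousMap.ext fun z => ?_
          simp [c0bhMul_apply]
        map_smul' := fun c a => by
          rw [RingHom.id_apply, ← map_smul]
          congr 1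
          refine ZeroAtInftyContinuousMap.ext fun z => ?_
          rw [map_smul, ZeroAtInftyContinuousMap.smul_apply, c0bhMul_apply, c0bhMul_apply,
            ZeroAtInftyContinuousMap.smul_apply, smul_comm] }
    obtain ⟨c, hc⟩ := c0bh_mult T ‖h‖ (norm_nonneg _) (by
      intro v g r hr
      have hr0 : 0 ≤ r := le_trans (norm_nonneg (g - (0 : ℂ) • v)) (hr 0 (by simp))
      change ‖g - Φ (c0bhMul h (Φ.symm v))‖ ≤ r
      rw [← Φ.symm.norm_map, c0bh_map_sub, Φ.symm_apply_apply]
      refine c0bh_norm_le _ hr0 fun z => ?_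
      have h1 := hr (h z) (h.norm_coe_le_norm _)
      rw [← Φ.symm.norm_map, c0bh_map_sub, map_smul] at h1
      exact (c0bh_norm_apply_le (Φ.symm g - h z • Φ.symm v) z).trans h1) y
    refine ⟨c, fun g => ?_⟩
    have := hc (Φ g)
    change Φ (c0bhMul h (Φ.symm (Φ g))) y = _ at this
    rwa [Φ.symm_apply_apply] at this
  choose χ hχ using hmul
  obtain ⟨g0, hg0⟩ : ∃ g0, Φ g0 y ≠ 0 := by
    obtain ⟨k, hk1, -, -, hkg⟩ := c0bh_bump (H := H) y _ univ_mem
    obtain ⟨g, hg⟩ := hkg 1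
    refine ⟨Φ.symm g, ?_⟩
    rw [Φ.apply_symm_apply, hg, hk1.self_of_nhds]
    simp
  have huniq : ∀ (h : C(OnePoint X, ℂ)) (c : ℂ), Φ (c0bhMul h g0) y = c • Φ g0 y → χ h = c := by
    intro h c hc
    rw [hχ] at hc
    exact smul_left_injective ℂ hg0 hc
  let ψ : C(OnePoint X, ℂ) →ₐ[ℂ] ℂ := AlgHom.ofLinearMap
    { toFun := χ
      map_add' := fun a b => huniq _ _ (by
        have : c0bhMul (a + b) g0 = c0bhMul a g0 + c0bhMul b g0 := by
          refine ZeroAtInftyContinuousMap.ext fun z => ?_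
          simp [c0bhMul_apply, add_smul]
        rw [this, map_add, ZeroAtInftyContinuousMap.add_apply, hχ, hχ, add_smul])
      map_smul' := fun c a => huniq _ _ (by
        have : c0bhMul (c • a) g0 = c • c0bhMul a g0 := by
          refine ZeroAtInftyContinuousMap.ext fun z => ?_
          rw [ZeroAtInftyContinuousMap.smul_apply, c0bhMul_apply, c0bhMul_apply,
            ContinuousMap.smul_apply, smul_assoc]
        rw [this, map_smul, ZeroAtInftyContinuousMap.smul_apply, hχ, RingHom.id_apply,
          smul_assoc]) }
    (huniq _ _ (by
      have : c0bhMul 1 g0 = g0 := by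
        refine ZeroAtInftyContinuousMap.ext fun z => ?_
        simp [c0bhMul_apply]
      rw [this, one_smul]))
    (fun a b => huniq _ _ (by
      have : c0bhMul (a * b) g0 = c0bhMul a (c0bhMul b g0) := by
        refine ZeroAtInftyContinuousMap.ext fun z => ?_
        simp [c0bhMul_apply, mul_smul]
      rw [this, hχ, hχ, smul_smul]; rfl))
  obtain ⟨p, hχp⟩ : ∃ p, ∀ h, χ h = h p := c0bh_char ψ
  have main : ∀ (f : C₀(X, H →L[ℂ] H)) (F : C(OnePoint X, H →L[ℂ] H)), (∀ x : X, F x = f x) →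
      F p = 0 → Φ f y = 0 := by
    intro f F hF hFp
    rw [← norm_le_zero_iff]
    refine le_of_forall_pos_le_add fun ε hε => ?_
    rw [zero_add]
    obtain ⟨k, hk0, hk1, hkI⟩ := exists_continuous_zero_one_of_isClosed
      (s := {q | ε ≤ ‖F q‖}) (t := {p}) (isClosed_le continuous_const F.continuous.norm)
      isClosed_singleton (by
        rw [Set.disjoint_singleton_right]
        simp [hFp, hε])
    let h : C(OnePoint X, ℂ) := ⟨fun q => (k q : ℂ), by fun_prop⟩
    have h1 : Φ (c0bhMul h f) y = Φ f y := by
      rw [hχ, hχp]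
      have : k p = 1 := hk1 rfl
      change (k p : ℂ) • _ = _
      rw [this]; simp
    rw [← h1]
    refine (c0bh_norm_apply_le _ y).trans ?_
    rw [Φ.norm_map]
    refine c0bh_norm_le _ hε.le fun z => ?_
    rw [c0bhMul_apply, norm_smul]
    change ‖(k z : ℂ)‖ * _ ≤ ε
    rw [Complex.norm_real, Real.norm_eq_abs, abs_of_nonneg (hkI z).1]
    by_cases hz : ε ≤ ‖F z‖
    · have : k z = 0 := hk0 hz
      rw [this, zero_mul]; exact hε.le
    · rw [hF] at hz
      push Not at hz
      calc k z * ‖f z‖ ≤ 1 * ‖f z‖ := by gcongr; exact (hkI z).2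
        _ ≤ ε := by rw [one_mul]; exact hz.le
  induction p using OnePoint.rec with
  | infty =>
    obtain ⟨F, hF0, hF⟩ := c0bh_ext g0
    exact absurd (main g0 F hF hF0) hg0
  | coe x =>
    refine ⟨x, fun f hf => ?_⟩
    obtain ⟨F, hF0, hF⟩ := c0bh_ext f
    exact main f F hF (by rw [hF, hf])

lemma c0bh_form [Nontrivial H] (Φ : C₀(X, H →L[ℂ] H) ≃ₗᵢ[ℂ] C₀(X, H →L[ℂ] H)) :
    ∃ (φ : X → X) (τ : X → (H →L[ℂ] H) →ₗ[ℂ] (H →L[ℂ] H)),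
      (∀ f y, Φ f y = τ y (f (φ y))) ∧ ∀ y A, ‖τ y A‖ ≤ ‖A‖ := by
  obtain ⟨φ, hφ⟩ := c0bh_point Φ
  have hb : ∀ x : X, ∃ k : X → ℝ, k x = 1 ∧ (∀ y, 0 ≤ k y ∧ k y ≤ 1) ∧
    ∀ A : H →L[ℂ] H, ∃ g : C₀(X, H →L[ℂ] H), ∀ y, g y = (k y : ℂ) • A := fun x => by
    obtain ⟨k, h1, -, h2, h3⟩ := c0bh_bump (H := H) x _ univ_mem
    exact ⟨k, h1.self_of_nhds, h2, h3⟩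
  choose k hk1 hkI G hG using hb
  have heq : ∀ (y : X) (f g : C₀(X, H →L[ℂ] H)), f (φ y) = g (φ y) → Φ f y = Φ g y := fun y f g h => by
    rw [← sub_eq_zero, ← ZeroAtInftyContinuousMap.sub_apply, ← c0bh_map_sub]
    exact hφ y _ (by rw [ZeroAtInftyContinuousMap.sub_apply, h, sub_self])
  have hGx : ∀ x A, G x A x = A := fun x A => by rw [hG, hk1]; simp
  refine ⟨φ, fun y =>
    { toFun := fun A => Φ (G (φ y) A) y
      map_add' := fun A B => by
        rw [← ZeroAtInftyContinuousMap.add_apply, ← map_add]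
        exact heq _ _ _ (by simp only [ZeroAtInftyContinuousMap.add_apply, hGx])
      map_smul' := fun c A => by
        rw [RingHom.id_apply, ← ZeroAtInftyContinuousMap.smul_apply, ← map_smul]
        exact heq _ _ _ (by simp only [ZeroAtInftyContinuousMap.smul_apply, hGx]) }, ?_, ?_⟩
  · intro f y
    exact heq _ _ _ (hGx _ _).symm
  · intro y A
    refine (c0bh_norm_apply_le _ y).trans ?_
    rw [Φ.norm_map]
    refine c0bh_norm_le _ (norm_nonneg _) fun z => ?_
    rw [hG, norm_smul, Complex.norm_real, Real.norm_eq_abs, abs_of_nonneg (hkI _ z).1]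
    exact mul_le_of_le_one_left (norm_nonneg _) (hkI _ z).2

lemma c0bh_inv [Nontrivial H] {Φ Ψ : C₀(X, H →L[ℂ] H) → C₀(X, H →L[ℂ] H)}
    (hinv : ∀ f, Ψ (Φ f) = f) {φ φ' : X → X} {τ τ' : X → (H →L[ℂ] H) →ₗ[ℂ] (H →L[ℂ] H)}
    (h : ∀ f y, Φ f y = τ y (f (φ y))) (h' : ∀ f y, Ψ f y = τ' y (f (φ' y))) :
    (∀ x, φ (φ' x) = x) ∧ ∀ x A, τ' x (τ (φ' x) A) = A := by
  have h1 : ∀ (f : C₀(X, H →L[ℂ] H)) (x : X), f x = τ' x (τ (φ' x) (f (φ (φ' x)))) := fun f x => by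
    rw [← h, ← h', hinv]
  have h2 : ∀ x, φ (φ' x) = x := by
    intro x
    by_contra hne
    obtain ⟨k, hk1, hk0, -, hkg⟩ := c0bh_bump (H := H) x {φ (φ' x)}ᶜ
      (isOpen_compl_singleton.mem_nhds (fun hh => hne hh.symm))
    obtain ⟨g, hg⟩ := hkg 1
    have := h1 g x
    rw [hg, hg, hk1.self_of_nhds, hk0 _ (by simp)] at this
    simp at this
  refine ⟨h2, fun x A => ?_⟩
  obtain ⟨k, hk1, -, -, hkg⟩ := c0bh_bump (H := H) x _ univ_mem
  obtain ⟨g, hg⟩ := hkg A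
  have := h1 g x
  rw [h2, hg, hk1.self_of_nhds] at this
  simpa using this.symm

lemma c0bh_cont [Nontrivial H] {Φ : C₀(X, H →L[ℂ] H) → C₀(X, H →L[ℂ] H)}
    {φ : X → X} {τ : X → (H →L[ℂ] H) →ₗ[ℂ] (H →L[ℂ] H)}
    (h : ∀ f y, Φ f y = τ y (f (φ y))) (hτ : ∀ y, Function.Injective (τ y)) :
    Continuous φ ∧ ∀ A, Continuous fun y => τ y A := by
  have hφ : Continuous φ := by
    rw [continuous_iff_continuousAt]
    intro y U hU
    obtain ⟨k, hk1, hk0, -, hkg⟩ := c0bh_bump (H := H) (φ y) U hU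
    obtain ⟨g, hg⟩ := hkg 1
    have h1 : Φ g y ≠ 0 := by
      rw [h, hg, hk1.self_of_nhds]
      intro h2
      have := hτ y (h2.trans (map_zero _).symm)
      simp at this
    have h2 := (Φ g).continuous.continuousAt.eventually_ne h1
    change ∀ᶠ z in 𝓝 y, φ z ∈ U
    filter_upwards [h2] with z hz
    by_contra hzU
    apply hz
    change Φ g z = 0
    rw [h, hg, hk0 _ hzU]; simp
  refine ⟨hφ, fun A => ?_⟩
  rw [continuous_iff_continuousAt]
  intro y
  obtain ⟨k, hk1, -, -, hkg⟩ := c0bh_bump (H := H) (φ y) _ univ_mem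
  obtain ⟨g, hg⟩ := hkg A
  refine (Φ g).continuous.continuousAt.congr ?_
  filter_upwards [hφ.continuousAt.eventually hk1] with z hz
  change Φ g z = τ z A
  rw [h, hg, hz]; simp
end helpers

/-- Every surjective linear isometry `Φ` of `C₀(X, B(H))` is of the form
`Φ(f)(x) = τ(x)(f(φ(x)))` where each `τ(x)` is a surjective linear isometry of `B(H)`,
the maps `x ↦ τ(x)` and `x ↦ τ(x)⁻¹` are strongly continuous, and `φ` is a
homeomorphism of `X`. -/
theorem surjective_isometry_of_C0_BH_form
    {H : Type*} [NormedAddCommGroup H] [InnerProductSpace ℂ H] [CompleteSpace H]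
    [TopologicalSpace.SeparableSpace H] (hH : ¬ FiniteDimensional ℂ H)
    {X : Type*} [TopologicalSpace X] [LocallyCompactSpace X] [T2Space X]
    (Φ : C₀(X, H →L[ℂ] H) → C₀(X, H →L[ℂ] H))
    (hΦ : IsSurjectiveLinearIsometry Φ) :
    ∃ (τ σ : X → (H →L[ℂ] H) → (H →L[ℂ] H)) (φ : X ≃ₜ X),
      (∀ x : X, IsSurjectiveLinearIsometry (τ x)) ∧
      (∀ x : X, Function.LeftInverse (σ x) (τ x) ∧ Function.RightInverse (σ x) (τ x)) ∧
      (∀ A : H →L[ℂ] H, Continuous fun x : X => τ x A) ∧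
      (∀ A : H →L[ℂ] H, Continuous fun x : X => σ x A) ∧
      ∀ (f : C₀(X, H →L[ℂ] H)) (x : X), Φ f x = τ x (f (φ x)) := by
  obtain ⟨hlin, hsurj, hnorm⟩ := hΦ
  have hnt : Nontrivial H := by
    by_contra hn
    rw [not_nontrivial_iff_subsingleton] at hn
    exact hH inferInstance
  let L : C₀(X, H →L[ℂ] H) →ₗᵢ[ℂ] C₀(X, H →L[ℂ] H) := ⟨hlin.mk' Φ, hnorm⟩
  let P : C₀(X, H →L[ℂ] H) ≃ₗᵢ[ℂ] C₀(X, H →L[ℂ] H) := LinearIsometryEquiv.ofSurjective L hsurj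
  have hP : ∀ f, P f = Φ f := fun f => rfl
  obtain ⟨φ, τ, h, hτ⟩ := c0bh_form P
  obtain ⟨φ', τ', h', hτ'⟩ := c0bh_form P.symm
  obtain ⟨hi1, hi2⟩ := c0bh_inv (Φ := P) (Ψ := P.symm) P.symm_apply_apply h h'
  obtain ⟨hj1, hj2⟩ := c0bh_inv (Φ := P.symm) (Ψ := P) P.apply_symm_apply h' h
  have hl : ∀ y A, τ' (φ y) (τ y A) = A := fun y A => by
    have := hi2 (φ y) A
    rwa [hj1] at this
  have hl' : ∀ y A, τ (φ' y) (τ' y A) = A := fun y A => by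
    have := hj2 (φ' y) A
    rwa [hi1] at this
  obtain ⟨c1, c2⟩ := c0bh_cont (Φ := P) h (fun y => Function.LeftInverse.injective (hl y))
  obtain ⟨c1', c2'⟩ := c0bh_cont (Φ := P.symm) h' (fun y => Function.LeftInverse.injective (hl' y))
  refine ⟨fun y => τ y, fun y => τ' (φ y),
    { toFun := φ, invFun := φ', left_inv := hj1, right_inv := hi1,
      continuous_toFun := c1, continuous_invFun := c1' }, ?_, ?_, c2,
    fun A => (c2' A).comp c1, fun f x => ?_⟩
  · intro x
    refine ⟨(τ x).isLinear, fun A => ⟨τ' (φ x) A, hj2 x A⟩, fun A => le_antisymm (hτ x A) ?_⟩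
    have := hτ' (φ x) (τ x A)
    rwa [hl] at this
  · intro x
    exact ⟨hl x, hj2 x⟩
  · rw [← hP, h]; rfl
end

section
/- Let X be a locally compact Hausdorff space. If the automorphism group of C₀(X) is algebraically reflexive, then the automorphism group of C₀(X, B(H)) is algebraically reflexive; that is, if every bounded linear map on C₀(X) that agrees at each point with some automorphism of C₀(X) is itself an automorphism, then every bounded linear map Φ on C₀(X, B(H)) such that for each f ∈ C₀(X, B(H)) there is an automorphism Φ_f of C₀(X, B(H)) with Φ(f) = Φ_f(f), is itself an automorphism of C₀(X, B(H)). -/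
open scoped ZeroAtInfty

namespace AutRefl

set_option linter.unusedSectionVars false

section Basis

variable {H : Type*} [NormedAddCommGroup H] [InnerProductSpace ℂ H] [CompleteSpace H]

lemma countable_of_dist {Y : Type*} [PseudoMetricSpace Y] [TopologicalSpace.SeparableSpace Y]
    {ι : Type*} (k : ι → Y) (δ : ℝ) (hδ : 0 < δ) (h : ∀ s t, s ≠ t → δ ≤ dist (k s) (k t)) :
    Countable ι := by
  refine Pairwise.countable_of_isOpen_disjoint (s := fun i => Metric.ball (k i) (δ / 2)) ?_
    (fun i => Metric.isOpen_ball) (fun i => ⟨k i, Metric.mem_ball_self (by positivity)⟩)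
  intro s t hst
  apply Metric.ball_disjoint_ball
  linarith [h s t hst]

lemma exists_basis [TopologicalSpace.SeparableSpace H] (hH : ¬ FiniteDimensional ℂ H)
    (ι : Type*) [Countable ι] [Infinite ι] : Nonempty (HilbertBasis ι ℂ H) := by
  obtain ⟨w, b, hb⟩ := exists_hilbertBasis ℂ H
  have hc : Countable w := by
    refine countable_of_dist (fun i : w => b i) 1 one_pos ?_
    intro s t hst
    have h1 : ‖b s - b t‖ ^ 2 = 2 := by
      rw [@norm_sub_sq ℂ, b.orthonormal.2 hst, b.orthonormal.1, b.orthonormal.1]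
      norm_num
    rw [dist_eq_norm]
    nlinarith [norm_nonneg (b s - b t)]
  have hi : Infinite w := by
    by_contra hfin
    rw [not_infinite_iff_finite] at hfin
    have := Fintype.ofFinite w
    exact hH (b.toOrthonormalBasis.toBasis.finiteDimensional_of_finite)
  obtain ⟨e⟩ := nonempty_equiv_of_countable (α := ι) (β := w)
  refine ⟨HilbertBasis.mk (v := b ∘ e) (b.orthonormal.comp e e.injective) ?_⟩
  rw [Set.range_comp, e.surjective.range_eq, Set.image_univ]
  exact b.dense_span.ge

variable {ι : Type*}

lemma ext_basis (b : HilbertBasis ι ℂ H) {S T : H →L[ℂ] H} (h : ∀ i, S (b i) = T (b i)) :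
    S = T := by
  refine ContinuousLinearMap.ext_on
    (Submodule.dense_iff_topologicalClosure_eq_top.2 b.dense_span) ?_
  rintro _ ⟨i, rfl⟩
  exact h i

lemma exists_inj_op (b : HilbertBasis ι ℂ H) (σ : ι → ι) (hσ : Function.Injective σ) :
    ∃ V : H →L[ℂ] H, (∀ i, V (b i) = b (σ i)) ∧ Function.Injective V := by
  classical
  have ho := (b.orthonormal.comp σ hσ).orthogonalFamily
  refine ⟨(ho.linearIsometry.toContinuousLinearMap).comp
    (b.repr.toLinearIsometry.toContinuousLinearMap), ?_, ?_⟩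
  · intro i
    simp only [ContinuousLinearMap.comp_apply, LinearIsometry.coe_toContinuousLinearMap,
      LinearIsometryEquiv.coe_toLinearIsometry, b.repr_self]
    rw [OrthogonalFamily.linearIsometry_apply_single]
    simp
  · exact ho.linearIsometry.injective.comp b.repr.injective

lemma exists_proj (b : HilbertBasis ι ℂ H) (N : Set ι) :
    ∃ P : H →L[ℂ] H, (∀ i ∈ N, P (b i) = b i) ∧ (∀ i ∉ N, P (b i) = 0) ∧ ‖P‖ ≤ 1 := by
  let K : Submodule ℂ H := (Submodule.span ℂ (b '' N)).topologicalClosure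
  have : CompleteSpace K :=
    (Submodule.isClosed_topologicalClosure _).completeSpace_coe
  refine ⟨K.starProjection, ?_, ?_, K.starProjection_norm_le⟩
  · intro i hi
    rw [Submodule.starProjection_eq_self_iff]
    exact Submodule.le_topologicalClosure _ (Submodule.subset_span ⟨i, hi, rfl⟩)
  · intro i hi
    rw [Submodule.starProjection_apply_eq_zero_iff]
    rw [Submodule.orthogonal_closure, Submodule.mem_orthogonal]
    intro u hu
    induction hu using Submodule.span_induction with
    | mem x hx =>
      obtain ⟨j, hj, rfl⟩ := hx
      exact b.orthonormal.2 (fun h => hi (h ▸ hj))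
    | zero => simp
    | add x y _ _ hx hy => rw [inner_add_left, hx, hy, add_zero]
    | smul a x _ hx => rw [inner_smul_left, hx, mul_zero]

end Basis

section Theta

lemma idem_orth {R : Type*} [Ring R] [Module ℂ R] {p q : R} (hp : p * p = p) (hq : q * q = q)
    (h : (p + q) * (p + q) = p + q) : p * q = 0 ∧ q * p = 0 := by
  have h1 : p * q + q * p = 0 := by
    have : (p + q) * (p + q) = p * p + q * q + (p * q + q * p) := by noncomm_ring
    rw [this, hp, hq] at h
    simpa using h
  have h2 : p * q + p * q * p = 0 := by
    have := congrArg (fun z => p * z) h1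
    simp only [mul_add, mul_zero, ← mul_assoc, hp] at this
    exact this
  have h3 : p * q * p + q * p = 0 := by
    have := congrArg (fun z => z * p) h1
    simp only [add_mul, zero_mul, mul_assoc, hp] at this
    simpa only [mul_assoc] using this
  have h4 : p * q = q * p := by
    have h5 : p * q = - (p * q * p) := eq_neg_of_add_eq_zero_left h2
    have h6 : q * p = - (p * q * p) := eq_neg_of_add_eq_zero_right h3
    rw [h5, h6]
  have h7 : (2 : ℂ) • (p * q) = 0 := by
    rw [two_smul]; nth_rewrite 2 [h4]; exact h1
  have h8 : p * q = 0 := by simpa using h7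
  exact ⟨h8, h4 ▸ h8⟩

lemma inf_invol {ι : Type*} [Countable ι] (N : Set ι) (h1 : N.Infinite) (h2 : Nᶜ.Infinite) :
    ∃ σ : ι → ι, (∀ i, σ (σ i) = i) ∧ ∀ i, σ i ∈ N ↔ i ∉ N := by
  classical
  have := h1.to_subtype
  have := h2.to_subtype
  obtain ⟨e⟩ := nonempty_equiv_of_countable (α := N) (β := (Nᶜ : Set ι))
  refine ⟨fun i => if h : i ∈ N then (e ⟨i, h⟩ : ι) else (e.symm ⟨i, h⟩ : ι), ?_, ?_⟩
  · intro i
    by_cases h : i ∈ N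
    · have : (e ⟨i, h⟩ : ι) ∉ N := (e ⟨i, h⟩).2
      simp [h, this]
    · have : (e.symm ⟨i, h⟩ : ι) ∈ N := (e.symm ⟨i, h⟩).2
      simp [h, this]
  · intro i
    by_cases h : i ∈ N
    · have : (e ⟨i, h⟩ : ι) ∉ N := (e ⟨i, h⟩).2
      simp [h, this]
    · have : (e.symm ⟨i, h⟩ : ι) ∈ N := (e.symm ⟨i, h⟩).2
      simp [h, this]

/-- Branch of the binary tree. -/
def branch (t : ℕ → Bool) : Set (List Bool) := Set.range (fun n => (List.range n).map t)

lemma branch_infinite (t : ℕ → Bool) : (branch t).Infinite := by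
  apply Set.infinite_range_of_injective
  intro m n h
  simpa using congrArg List.length h

lemma branch_inter (s t : ℕ → Bool) (hst : s ≠ t) : (branch s ∩ branch t).Finite := by
  obtain ⟨k, hk⟩ := Function.ne_iff.1 hst
  refine ((Set.finite_Iic k).image (fun n => (List.range n).map s)).subset ?_
  rintro _ ⟨⟨n, rfl⟩, ⟨m, hm⟩⟩
  refine ⟨n, ?_, rfl⟩
  by_contra hn
  have hn' : k < n := by simpa using hn
  have hl : m = n := by simpa using congrArg List.length hm
  subst hl
  have := congrArg (fun l => l[k]?) hm
  simp [List.getElem?_range hn'] at this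
  exact hk this.symm

lemma branch_compl_infinite (t : ℕ → Bool) : ((branch t)ᶜ).Infinite := by
  have h : (fun n => !(t n)) ≠ t := by
    intro h
    have := congrFun h 0
    simp at this
  refine ((branch_infinite (fun n => !(t n))).sdiff (branch_inter _ t h)).mono ?_
  rintro x ⟨hx, hx'⟩ hxt
  exact hx' ⟨hx, hxt⟩

lemma not_countable_branches : ¬ Countable (ℕ → Bool) := by
  intro h
  obtain ⟨f, hf⟩ := exists_surjective_nat (ℕ → Bool)
  obtain ⟨n, hn⟩ := hf (fun n => !(f n n))
  have := congrFun hn n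
  simp at this

variable {H : Type*} [NormedAddCommGroup H] [InnerProductSpace ℂ H] [CompleteSpace H]

open InnerProductSpace in
lemma theta_zero [TopologicalSpace.SeparableSpace H] (hH : ¬ FiniteDimensional ℂ H)
    (θ : (H →L[ℂ] H) →ₗ[ℂ] (H →L[ℂ] H)) (C : ℝ) (hC : ∀ P, ‖θ P‖ ≤ C * ‖P‖)
    (hid : ∀ P, P * P = P → θ P * θ P = θ P) (hfin : ∀ x y : H, θ (rankOne ℂ x y) = 0) :
    θ 1 = 0 := by
  classical
  obtain ⟨b⟩ := exists_basis hH (List Bool)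
  choose P hP1 hP0 hPn using fun N : Set (List Bool) => exists_proj b N
  have hPP : ∀ N M, P N * P M = P (N ∩ M) := by
    intro N M
    apply ext_basis b
    intro i
    by_cases h1 : i ∈ N <;> by_cases h2 : i ∈ M <;>
      simp [h1, h2, hP1, hP0]
  have hPidem : ∀ N, P N * P N = P N := fun N => by rw [hPP, Set.inter_self]
  have hPempty : P ∅ = 0 := by
    apply ext_basis b
    intro i
    simp [hP0]
  have hPfin : ∀ N, N.Finite → θ (P N) = 0 := by
    intro N hN
    have : P N = ∑ i ∈ hN.toFinset, rankOne ℂ (b i) (b i) := by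
      apply ext_basis b
      intro j
      rw [sum_apply]
      simp only [rankOne_apply, orthonormal_iff_ite.1 b.orthonormal, ite_smul, one_smul,
        zero_smul, Finset.sum_ite_eq', Set.Finite.mem_toFinset]
      split_ifs with h
      · exact hP1 _ _ h
      · exact hP0 _ _ h
    rw [this, map_sum]
    exact Finset.sum_eq_zero (fun i _ => hfin _ _)
  have hPadd : ∀ N M, Disjoint N M → P (N ∪ M) = P N + P M := by
    intro N M hNM
    apply ext_basis b
    intro i
    by_cases h1 : i ∈ N
    · have h2 : i ∉ M := Set.disjoint_left.1 hNM h1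
      simp [h1, h2, hP1, hP0]
    · by_cases h2 : i ∈ M <;> simp [h1, h2, hP1, hP0]
  have horth : ∀ N M, (N ∩ M).Finite → θ (P N) * θ (P M) = 0 := by
    intro N M hNM
    have h1 : P N = P (N \ M) + P (N ∩ M) := by
      rw [← hPadd _ _ Set.disjoint_sdiff_inter, Set.sdiff_union_inter]
    have h2 : θ (P N) = θ (P (N \ M)) := by
      rw [h1, map_add, hPfin _ hNM, add_zero]
    rw [h2]
    refine (idem_orth (hid _ (hPidem _)) (hid _ (hPidem _)) ?_).1
    rw [← map_add]
    apply hid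
    rw [← hPadd _ _ Set.disjoint_sdiff_left, hPidem]
  obtain ⟨t, ht⟩ : ∃ t, θ (P (branch t)) = 0 := by
    by_contra! hne
    have hv : ∀ t, ∃ k : H, ‖k‖ = 1 ∧ θ (P (branch t)) k = k := by
      intro t
      obtain ⟨v, hv⟩ : ∃ v, θ (P (branch t)) v ≠ 0 := by
        by_contra! h
        exact hne t (ContinuousLinearMap.ext h)
      have hpp : θ (P (branch t)) (θ (P (branch t)) v) = θ (P (branch t)) v :=
        congrArg (fun T : H →L[ℂ] H => T v) (hid _ (hPidem (branch t)))
      refine ⟨((‖θ (P (branch t)) v‖ : ℂ)⁻¹) • θ (P (branch t)) v, ?_, ?_⟩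
      · rw [norm_smul, norm_inv, Complex.norm_real, norm_norm]
        exact inv_mul_cancel₀ (norm_ne_zero_iff.2 hv)
      · rw [map_smul, hpp]
    choose k hk1 hk using hv
    refine not_countable_branches (countable_of_dist k (1 / (|C| + 1)) (by positivity) ?_)
    intro s t hst
    have h0 : θ (P (branch s)) (k t) = 0 := by
      rw [← hk t]
      exact congrArg (fun T : H →L[ℂ] H => T (k t)) (horth _ _ (branch_inter s t hst))
    have h1 : k s = θ (P (branch s)) (k s - k t) := by rw [map_sub, h0, hk, sub_zero]
    have h2 : (1 : ℝ) ≤ (|C| + 1) * ‖k s - k t‖ := by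
      calc (1 : ℝ) = ‖k s‖ := (hk1 s).symm
        _ ≤ ‖θ (P (branch s))‖ * ‖k s - k t‖ := by
          conv_lhs => rw [h1]
          exact ContinuousLinearMap.le_opNorm _ _
        _ ≤ _ := by
          gcongr
          have := hC (P (branch s))
          have h3 := hPn (branch s)
          nlinarith [le_abs_self C, abs_nonneg C, norm_nonneg (P (branch s))]
    rw [dist_eq_norm, div_le_iff₀ (by positivity)]
    linarith
  obtain ⟨σ, hσ, hσN⟩ := inf_invol (branch t) (branch_infinite t) (branch_compl_infinite t)
  obtain ⟨U, hU, -⟩ := exists_inj_op b σ (Function.LeftInverse.injective hσ)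
  set Q := P (branch t) with hQ
  have hQQ : Q * Q = Q := hPidem _
  have hUU : U * U = 1 := by
    apply ext_basis b
    intro i
    simp [hU, hσ]
  have hUQ : U * Q = U - Q * U := by
    apply ext_basis b
    intro i
    by_cases h : i ∈ branch t
    · have h' : σ i ∉ branch t := by rw [hσN]; simpa using h
      simp [hU, hQ, hP1 _ _ h, hP0 _ _ h']
    · have h' : σ i ∈ branch t := by rw [hσN]; exact h
      simp [hU, hQ, hP0 _ _ h, hP1 _ _ h']
  have hQUQ : Q * U * Q = 0 := by
    rw [mul_assoc, hUQ, mul_sub, ← mul_assoc, hQQ, sub_self]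
  have key : ∀ n : H →L[ℂ] H, (Q + n) * (Q + n) = Q + n → (Q - n) * (Q - n) = Q - n →
      θ n = 0 := by
    intro n h1 h2
    have e1 := hid _ h1
    have e2 := hid _ h2
    rw [map_add, ht, zero_add] at e1
    rw [map_sub, ht, zero_sub, neg_mul_neg, e1] at e2
    have : (2 : ℂ) • θ n = 0 := by
      rw [two_smul]; nth_rewrite 1 [e2]; exact neg_add_cancel _
    simpa using this
  have hQU : θ (Q * U) = 0 := by
    apply key
    · have : (Q + Q * U) * (Q + Q * U) = Q * Q + Q * Q * U + Q * U * Q + Q * U * Q * U := by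
        noncomm_ring
      rw [this, hQUQ, hQQ]; simp
    · have : (Q - Q * U) * (Q - Q * U) = Q * Q - Q * Q * U - Q * U * Q + Q * U * Q * U := by
        noncomm_ring
      rw [this, hQUQ, hQQ]; simp
  have hUQ' : θ (U * Q) = 0 := by
    apply key
    · have : (Q + U * Q) * (Q + U * Q) = Q * Q + Q * U * Q + U * (Q * Q) + U * (Q * U * Q) := by
        noncomm_ring
      rw [this, hQUQ, hQQ]; simp
    · have : (Q - U * Q) * (Q - U * Q) = Q * Q - Q * U * Q - U * (Q * Q) + U * (Q * U * Q) := by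
        noncomm_ring
      rw [this, hQUQ, hQQ]; simp
  have hθU : θ U = 0 := by
    have : U = U * Q + Q * U := by rw [hUQ]; abel
    rw [this, map_add, hQU, hUQ', add_zero]
  have hlast : ((1 / 2 : ℂ) • (1 + U)) * ((1 / 2 : ℂ) • (1 + U)) = (1 / 2 : ℂ) • (1 + U) := by
    rw [smul_mul_smul_comm]
    have : (1 + U) * (1 + U) = (2 : ℂ) • (1 + U) := by
      have : (1 + U) * (1 + U) = 1 + U + U + U * U := by noncomm_ring
      rw [this, hUU, two_smul]; abel
    rw [this, smul_smul]; norm_num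
  have h9 := hid _ hlast
  rw [map_smul, map_add, hθU, add_zero, smul_mul_smul_comm, hid 1 (one_mul 1)] at h9
  have h10 : ((1 / 2 : ℂ) * (1 / 2) - 1 / 2) • θ 1 = 0 := by rw [sub_smul, h9, sub_self]
  rcases smul_eq_zero.1 h10 with h | h
  · norm_num at h
  · exact h

end Theta

section LocalBH

open InnerProductSpace

variable {H : Type*} [NormedAddCommGroup H] [InnerProductSpace ℂ H] [CompleteSpace H]

lemma mul_ap (S T : H →L[ℂ] H) (v : H) : (S * T) v = S (T v) := rfl

/-- Pointwise agreement with automorphisms. -/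
def IsLocal {A : Type*} [NonUnitalNonAssocSemiring A] [Module ℂ A] (ψ : A → A) : Prop :=
  ∀ a, ∃ τ : A → A, IsAlgebraAutomorphism τ ∧ ψ a = τ a

section gen
variable {A : Type*} [Ring A] [Algebra ℂ A]

lemma aut_zero {τ : A → A} (h : IsAlgebraAutomorphism τ) : τ 0 = 0 := h.1.map_zero

lemma aut_one {τ : A → A} (h : IsAlgebraAutomorphism τ) : τ 1 = 1 := by
  obtain ⟨a, ha⟩ := h.2.2.2 1
  have := h.2.1 1 a
  rw [one_mul, ha, mul_one] at this
  exact this.symm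

lemma aut_isUnit {τ : A → A} (h : IsAlgebraAutomorphism τ) {a : A} : IsUnit (τ a) ↔ IsUnit a := by
  constructor
  · rintro ⟨u, hu⟩
    obtain ⟨v, hv⟩ := h.2.2.2 ↑(u⁻¹)
    refine ⟨⟨a, v, ?_, ?_⟩, rfl⟩
    · apply h.2.2.1
      rw [h.2.1, hv, ← hu, aut_one h, Units.mul_inv]
    · apply h.2.2.1
      rw [h.2.1, hv, ← hu, aut_one h, Units.inv_mul]
  · rintro ⟨u, rfl⟩
    refine ⟨⟨τ u, τ ↑(u⁻¹), ?_, ?_⟩, rfl⟩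
    · rw [← h.2.1, Units.mul_inv, aut_one h]
    · rw [← h.2.1, Units.inv_mul, aut_one h]

variable {ψ : A → A}

lemma loc_one (hψ : IsLocal ψ) : ψ 1 = 1 := by
  obtain ⟨τ, h, e⟩ := hψ 1
  rw [e, aut_one h]

lemma loc_sq (hψ : IsLocal ψ) {a : A} {c : ℂ} (ha : a * a = c • a) : ψ a * ψ a = c • ψ a := by
  obtain ⟨τ, h, e⟩ := hψ a
  rw [e, ← h.2.1, ha, h.1.map_smul]

lemma loc_idem (hψ : IsLocal ψ) {a : A} (ha : a * a = a) : ψ a * ψ a = ψ a := by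
  have := loc_sq hψ (a := a) (c := 1) (by simpa using ha)
  simpa using this

lemma loc_sq_zero (hψ : IsLocal ψ) {a : A} (ha : a * a = 0) : ψ a * ψ a = 0 := by
  have := loc_sq hψ (a := a) (c := 0) (by simpa using ha)
  simpa using this

lemma loc_sq_zero_rev (hψ : IsLocal ψ) {a : A} (ha : ψ a * ψ a = 0) : a * a = 0 := by
  obtain ⟨τ, h, e⟩ := hψ a
  apply h.2.2.1
  rw [h.2.1, ← e, ha, aut_zero h]

lemma loc_unit (hψ : IsLocal ψ) {a : A} (ha : IsUnit a) : IsUnit (ψ a) := by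
  obtain ⟨τ, h, e⟩ := hψ a
  rw [e, aut_isUnit h]; exact ha

lemma loc_ne_zero (hψ : IsLocal ψ) {a : A} (ha : a ≠ 0) : ψ a ≠ 0 := by
  obtain ⟨τ, h, e⟩ := hψ a
  rw [e]
  intro h0
  exact ha (h.2.2.1 (h0.trans (aut_zero h).symm))

lemma loc_zd (hψ : IsLocal ψ) {a b : A} (hab : a * b = 0) (hb : b ≠ 0) : ∃ c, c ≠ 0 ∧ ψ a * c = 0 := by
  obtain ⟨τ, h, e⟩ := hψ a
  refine ⟨τ b, fun h0 => hb (h.2.2.1 (h0.trans (aut_zero h).symm)), ?_⟩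
  rw [e, ← h.2.1, hab, aut_zero h]

lemma loc_zd_rev (hψ : IsLocal ψ) {a c : A} (hab : ψ a * c = 0) (hc : c ≠ 0) : ∃ b, b ≠ 0 ∧ a * b = 0 := by
  obtain ⟨τ, h, e⟩ := hψ a
  obtain ⟨b, rfl⟩ := h.2.2.2 c
  refine ⟨b, fun h0 => hc (by rw [h0, aut_zero h]), ?_⟩
  apply h.2.2.1
  rw [h.2.1, ← e, hab, aut_zero h]

lemma loc_rank (hψ : IsLocal ψ) {a : A} (ha : ∀ b, ∃ c : ℂ, a * b * a = c • a) (b : A) :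
    ∃ c : ℂ, ψ a * b * ψ a = c • ψ a := by
  obtain ⟨τ, h, e⟩ := hψ a
  obtain ⟨b, rfl⟩ := h.2.2.2 b
  obtain ⟨c, hc⟩ := ha b
  refine ⟨c, ?_⟩
  rw [e, ← h.2.1, ← h.2.1, hc, h.1.map_smul]

end gen

/-- A rank one idempotent (in the algebraic sense). -/
lemma rank_one_form {p : H →L[ℂ] H} (hp : p * p = p) (h0 : p ≠ 0)
    (hr : ∀ b, ∃ c : ℂ, p * b * p = c • p) :
    ∃ e f : H, p = rankOne ℂ e f ∧ inner ℂ f e = (1 : ℂ) := by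
  obtain ⟨v, hv⟩ : ∃ v, p v ≠ 0 := by
    by_contra! h
    exact h0 (ContinuousLinearMap.ext h)
  set w := p v with hw
  have hpw : p w = w := congrArg (fun T : H →L[ℂ] H => T v) hp
  have hn : (inner ℂ w w : ℂ) ≠ 0 := inner_self_ne_zero.2 hv
  have hc : ∀ z, ∃ c : ℂ, p z = c • w := by
    intro z
    obtain ⟨c, hc⟩ := hr (rankOne ℂ z w)
    have h1 := congrArg (fun T : H →L[ℂ] H => T w) hc
    simp only [mul_ap, hpw, rankOne_apply, map_smul,
      smul_apply] at h1
    refine ⟨(inner ℂ w w : ℂ)⁻¹ * c, ?_⟩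
    rw [mul_smul, ← h1, smul_smul, inv_mul_cancel₀ hn, one_smul]
  refine ⟨w, (starRingEnd ℂ (inner ℂ w w : ℂ)⁻¹) • ContinuousLinearMap.adjoint p w, ?_, ?_⟩
  · ext z
    obtain ⟨c, hc⟩ := hc z
    rw [rankOne_apply, inner_smul_left, ContinuousLinearMap.adjoint_inner_left, hc,
      inner_smul_right]
    congr 1
    rw [Complex.conj_conj]
    field_simp
  · rw [inner_smul_left, ContinuousLinearMap.adjoint_inner_left, hpw, Complex.conj_conj,
      inv_mul_cancel₀ hn]

lemma dichotomy {e f : H} (hfe : inner ℂ f e = (1 : ℂ)) {n : H →L[ℂ] H} (hn : n * n = 0)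
    (h : rankOne ℂ e f * n + n * rankOne ℂ e f = n) :
    n = rankOne ℂ (n e) f + rankOne ℂ e (ContinuousLinearMap.adjoint n f) ∧
    inner ℂ f (n e) = (0 : ℂ) ∧ (n e = 0 ∨ ContinuousLinearMap.adjoint n f = 0) := by
  have h1 : ∀ v, n v = (inner ℂ f (n v) : ℂ) • e + (inner ℂ f v : ℂ) • n e := by
    intro v
    have := congrArg (fun T : H →L[ℂ] H => T v) h
    simp only [add_apply, mul_ap, rankOne_apply,
      map_smul] at this
    exact this.symm
  have h2 : inner ℂ f (n e) = (0 : ℂ) := by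
    have := congrArg (fun z => (inner ℂ f z : ℂ)) (h1 e)
    simp only [inner_add_right, inner_smul_right, hfe, mul_one, one_mul] at this
    simpa using this
  have hnn : ∀ v, n (n v) = 0 := fun v => congrArg (fun T : H →L[ℂ] H => T v) hn
  refine ⟨?_, h2, ?_⟩
  · ext v
    rw [add_apply, rankOne_apply, rankOne_apply,
      ContinuousLinearMap.adjoint_inner_left, add_comm]
    exact h1 v
  · by_cases hu : n e = 0
    · exact Or.inl hu
    · right
      refine ext_inner_right ℂ (fun v => ?_)
      rw [ContinuousLinearMap.adjoint_inner_left, inner_zero_left]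
      have h3 : (inner ℂ f (n v) : ℂ) • n e = 0 := by
        have := congrArg n (h1 v)
        rw [hnn, map_add, map_smul, map_smul, hnn, smul_zero, add_zero] at this
        exact this.symm
      exact (smul_eq_zero.1 h3).resolve_right hu

end LocalBH

section LocalBH2

set_option linter.unusedSectionVars false

open InnerProductSpace

variable {H : Type*} [NormedAddCommGroup H] [InnerProductSpace ℂ H] [CompleteSpace H]

lemma r1_mul (x y z w : H) : rankOne ℂ x y * rankOne ℂ z w = (inner ℂ y z : ℂ) • rankOne ℂ x w := by
  ext v
  simp only [mul_ap, rankOne_apply, map_smul, smul_apply, smul_smul, mul_comm]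

/-- An idempotent orthogonal to `E` has image orthogonal to the image of `E`. -/
lemma loc_orth {ψ : (H →L[ℂ] H) →L[ℂ] (H →L[ℂ] H)} (hψ : IsLocal ψ) {E R : H →L[ℂ] H}
    (hE : E * E = E) (hR : R * R = R) (h1 : E * R = 0) (h2 : R * E = 0) :
    ψ E * ψ R = 0 ∧ ψ R * ψ E = 0 := by
  refine idem_orth (loc_idem hψ hE) (loc_idem hψ hR) ?_
  rw [← map_add]
  apply loc_idem hψ
  rw [add_mul, mul_add, mul_add, hE, hR, h1, h2]; simp

lemma bad_case {ψ : (H →L[ℂ] H) →L[ℂ] (H →L[ℂ] H)} (hψ : IsLocal ψ) (b : HilbertBasis ℕ ℂ H)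
    (h : ψ (rankOne ℂ (b 1) (b 0)) * ψ (rankOne ℂ (b 0) (b 0)) = 0) : False := by
  have hin : ∀ i j, (inner ℂ (b i) (b j) : ℂ) = if i = j then 1 else 0 :=
    orthonormal_iff_ite.1 b.orthonormal
  obtain ⟨V, hV, hVinj⟩ := exists_inj_op b Nat.succ Nat.succ_injective
  set E := rankOne ℂ (b 0) (b 0) with hE
  have hEb : ∀ i, E (b i) = if i = 0 then b 0 else 0 := by
    intro i
    rw [hE, rankOne_apply, hin]
    by_cases h : i = 0
    · simp [h]
    · simp [h, Ne.symm h]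
  have hEE : E * E = E := by
    rw [hE, r1_mul, hin]; simp
  have key : ∀ N : Set ℕ, 0 ∉ N → (∀ i ∈ N, i + 1 ∉ N) → ∀ Q : H →L[ℂ] H,
      (∀ i ∈ N, Q (b i) = b i) → (∀ i ∉ N, Q (b i) = 0) → ψ (V * Q) * ψ E = 0 := by
    intro N hN0 hN Q hQ1 hQ0
    have hQQ : Q * Q = Q := by
      apply ext_basis b
      intro i
      by_cases h : i ∈ N <;> simp [h, hQ1, hQ0]
    have hQV : Q * (V * Q) = 0 := by
      apply ext_basis b
      intro i
      by_cases h : i ∈ N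
      · simp [h, hQ1, hQ0, hV, hN i h]
      · simp [h, hQ0]
    have hEQ : E * Q = 0 := by
      apply ext_basis b
      intro i
      by_cases h : i ∈ N
      · have : i ≠ 0 := fun h0 => hN0 (h0 ▸ h)
        simp [h, hQ1, hEb, this]
      · simp [h, hQ0]
    have hQE : Q * E = 0 := by
      apply ext_basis b
      intro i
      by_cases h : i = 0
      · simp [h, hEb, hQ0 0 hN0]
      · simp [h, hEb]
    have hEVQ : E * (V * Q) = 0 := by
      apply ext_basis b
      intro i
      by_cases h : i ∈ N
      · simp [h, hQ1, hV, hEb]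
      · simp [h, hQ0]
    have h1 := (loc_orth hψ hEE hQQ hEQ hQE).2
    have h2 := (loc_orth hψ (R := Q + V * Q) hEE ?_ ?_ ?_).2
    · rw [map_add, add_mul, h1, zero_add] at h2
      exact h2
    · have : (Q + V * Q) * (Q + V * Q) = Q * Q + Q * (V * Q) + V * (Q * Q) + V * (Q * (V * Q)) := by
        noncomm_ring
      rw [this, hQQ, hQV]; simp
    · rw [mul_add, hEQ, hEVQ, add_zero]
    · rw [add_mul, mul_assoc, hQE, mul_zero, add_zero]
  obtain ⟨Q1, hQ1, hQ1', -⟩ := exists_proj b {i | i % 2 = 1}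
  obtain ⟨Q2, hQ2, hQ2', -⟩ := exists_proj b {i | i % 2 = 0 ∧ i ≠ 0}
  have hsum : V = rankOne ℂ (b 1) (b 0) + V * Q1 + V * Q2 := by
    apply ext_basis b
    intro i
    simp only [add_apply, mul_ap, rankOne_apply, hin]
    rcases Nat.mod_two_eq_zero_or_one i with h | h
    · by_cases h0 : i = 0
      · subst h0
        rw [hQ1' 0 (by simp), hQ2' 0 (by simp), hV]; simp
      · rw [hQ1' i (by simp [h]), hQ2 i (by simp [h, h0]), hV]; simp [Ne.symm h0]
    · have h0 : i ≠ 0 := by rintro rfl; simp at h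
      rw [hQ1 i (by simp [h]), hQ2' i (by simp [h]), hV]; simp [Ne.symm h0]
  have h1 := key _ (by simp) (by intro i hi; simp at hi ⊢; omega) Q1 hQ1 hQ1'
  have h2 := key _ (by simp) (by intro i hi; simp at hi ⊢; omega) Q2 hQ2 hQ2'
  have h3 : ψ V * ψ E = 0 := by
    rw [hsum, map_add, map_add, add_mul, add_mul, h, h1, h2]; simp
  have hE0 : E ≠ 0 := by
    intro h0
    have := hEb 0
    rw [h0] at this
    have hb := b.orthonormal.1 0
    simp at this
    rw [← this] at hb
    simp at hb
  obtain ⟨B, hB0, hB⟩ := loc_zd_rev hψ h3 (loc_ne_zero hψ hE0)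
  apply hB0
  ext v
  apply hVinj
  rw [zero_apply, map_zero]
  exact congrArg (fun T : H →L[ℂ] H => T v) hB

set_option maxHeartbeats 2000000 in
lemma structure_thm [TopologicalSpace.SeparableSpace H] (hH : ¬ FiniteDimensional ℂ H)
    {ψ : (H →L[ℂ] H) →L[ℂ] (H →L[ℂ] H)} (hψ : IsLocal ψ) :
    ∃ S M : H →L[ℂ] H, (∀ x y, ψ (rankOne ℂ x y) = rankOne ℂ (S x) (M y)) ∧
      ∀ x y, (inner ℂ (M y) (S x) : ℂ) = inner ℂ y x := by
  obtain ⟨b⟩ := exists_basis hH ℕ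
  set e := b 0 with he
  have hee : (inner ℂ e e : ℂ) = 1 := by
    rw [he, inner_self_eq_norm_sq_to_K, b.orthonormal.1]; simp
  have he0 : e ≠ 0 := by
    rintro h0
    rw [h0] at hee
    simp at hee
  have hEE : rankOne ℂ e e * rankOne ℂ e e = rankOne ℂ e e := by
    rw [r1_mul, hee, one_smul]
  obtain ⟨e', f, hE', hfe⟩ := rank_one_form (loc_idem hψ hEE)
    (loc_ne_zero hψ (rankOne_ne_zero he0 he0))
    (loc_rank hψ (by
      intro B
      refine ⟨inner ℂ e (B e), ?_⟩
      ext v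
      simp only [mul_ap, rankOne_apply, map_smul, smul_apply, smul_smul, mul_comm]))
  -- the dichotomy
  have hdich : ∀ A : H →L[ℂ] H, A * A = 0 → rankOne ℂ e e * A + A * rankOne ℂ e e = A →
      ψ A = rankOne ℂ (ψ A e') f + rankOne ℂ e' (ContinuousLinearMap.adjoint (ψ A) f) ∧
      inner ℂ f (ψ A e') = (0 : ℂ) ∧
        (ψ A e' = 0 ∨ ContinuousLinearMap.adjoint (ψ A) f = 0) := by
    intro A hA hEA
    have hn := loc_sq_zero hψ hA
    refine dichotomy hfe hn ?_
    have h1 : (rankOne ℂ e e + A) * (rankOne ℂ e e + A) = rankOne ℂ e e + A := by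
      calc _ = rankOne ℂ e e * rankOne ℂ e e + (rankOne ℂ e e * A + A * rankOne ℂ e e) + A * A := by
            noncomm_ring
        _ = _ := by rw [hEE, hEA, hA, add_zero]
    have h2 := loc_idem hψ h1
    rw [map_add] at h2
    have h3 : (ψ (rankOne ℂ e e) + ψ A) * (ψ (rankOne ℂ e e) + ψ A) =
        ψ (rankOne ℂ e e) * ψ (rankOne ℂ e e) +
        (ψ (rankOne ℂ e e) * ψ A + ψ A * ψ (rankOne ℂ e e)) + ψ A * ψ A := by
      noncomm_ring
    rw [h3, loc_idem hψ hEE, hn, add_zero] at h2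
    have h4 := add_left_cancel h2
    rw [hE'] at h4
    exact h4
  let S : H →L[ℂ] H := (ContinuousLinearMap.apply ℂ H e').comp
    (ψ.comp ((rankOne ℂ : H →L[ℂ] H →L⋆[ℂ] H →L[ℂ] H).flip e))
  have hS : ∀ x, S x = ψ (rankOne ℂ x e) e' := fun x => rfl
  let M : H →L[ℂ] H := ((ContinuousLinearMap.apply ℂ H f).comp
    ((ContinuousLinearMap.adjoint (𝕜 := ℂ) (E := H) (F := H)).toContinuousLinearEquiv :
      (H →L[ℂ] H) →L⋆[ℂ] (H →L[ℂ] H))).comp (ψ.comp (rankOne ℂ e : H →L⋆[ℂ] H →L[ℂ] H))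
  have hM : ∀ y, M y = ContinuousLinearMap.adjoint (ψ (rankOne ℂ e y)) f := fun y => rfl
  have hSe : S e = e' := by rw [hS, hE', rankOne_apply, hfe, one_smul]
  have hMe : M e = f := by
    rw [hM, hE', adjoint_rankOne, rankOne_apply]
    have : (inner ℂ e' f : ℂ) = 1 := by rw [← inner_conj_symm, hfe, map_one]
    rw [this, one_smul]
  -- images of `x ⊗ e`
  have hsqx : ∀ x, (inner ℂ e x : ℂ) = 0 → rankOne ℂ x e * rankOne ℂ x e = 0 ∧
      rankOne ℂ e e * rankOne ℂ x e + rankOne ℂ x e * rankOne ℂ e e = rankOne ℂ x e := by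
    intro x hx
    rw [r1_mul, r1_mul, r1_mul, hx, hee]; simp
  have hsqy : ∀ y, (inner ℂ e y : ℂ) = 0 → rankOne ℂ e y * rankOne ℂ e y = 0 ∧
      rankOne ℂ e e * rankOne ℂ e y + rankOne ℂ e y * rankOne ℂ e e = rankOne ℂ e y := by
    intro y hy
    have hy' : (inner ℂ y e : ℂ) = 0 := inner_eq_zero_symm.1 hy
    rw [r1_mul, r1_mul, r1_mul, hy', hee]; simp
  have hb1 : (inner ℂ e (b 1) : ℂ) = 0 := b.orthonormal.2 (by simp)
  have hSb1 : S (b 1) ≠ 0 := by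
    intro h0
    apply bad_case hψ b
    rw [← he, hE']
    ext v
    rw [mul_ap, rankOne_apply, map_smul, ← hS, h0]; simp
  have hgood : ∀ x, (inner ℂ e x : ℂ) = 0 →
      ContinuousLinearMap.adjoint (ψ (rankOne ℂ x e)) f = 0 := by
    have h1 := ((hdich _ (hsqx _ hb1).1 (hsqx _ hb1).2).2.2).resolve_left hSb1
    intro x hx
    rcases (hdich _ (hsqx _ hx).1 (hsqx _ hx).2).2.2 with h2 | h2
    · have h3 : (inner ℂ e (x + b 1) : ℂ) = 0 := by rw [inner_add_right, hx, hb1, add_zero]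
      rcases (hdich _ (hsqx _ h3).1 (hsqx _ h3).2).2.2 with h4 | h4
      · exfalso
        rw [← hS, map_add, hS x, h2, zero_add] at h4
        exact hSb1 h4
      · rw [map_add, add_apply, map_add, map_add, add_apply, h1, add_zero] at h4
        exact h4
    · exact h2
  have hSx : ∀ x, (inner ℂ e x : ℂ) = 0 → ψ (rankOne ℂ x e) = rankOne ℂ (S x) f ∧
      (inner ℂ f (S x) : ℂ) = 0 := by
    intro x hx
    obtain ⟨h1, h2, -⟩ := hdich _ (hsqx _ hx).1 (hsqx _ hx).2
    rw [hgood x hx, map_zero, add_zero] at h1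
    exact ⟨h1, h2⟩
  have hMy : ∀ y, (inner ℂ e y : ℂ) = 0 → ψ (rankOne ℂ e y) = rankOne ℂ e' (M y) ∧
      (inner ℂ (M y) e' : ℂ) = 0 := by
    intro y hy
    obtain ⟨h1, h2, h3⟩ := hdich _ (hsqy _ hy).1 (hsqy _ hy).2
    have h4 : ψ (rankOne ℂ e y) e' = 0 := by
      by_contra hne
      have h5 := h3.resolve_left hne
      rw [h5, map_zero, add_zero] at h1
      have h6 : ψ (rankOne ℂ y e + rankOne ℂ e y) * ψ (rankOne ℂ y e + rankOne ℂ e y) = 0 := by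
        rw [map_add, (hSx y hy).1, h1]
        simp only [add_mul, mul_add, r1_mul, (hSx y hy).2, h2, zero_smul, add_zero]
      have h7 := loc_sq_zero_rev hψ h6
      have hye : (inner ℂ y e : ℂ) = 0 := inner_eq_zero_symm.1 hy
      have h8 := congrArg (fun T : H →L[ℂ] H => T e) h7
      simp only [add_mul, mul_add, r1_mul, add_apply, smul_apply, rankOne_apply, hee, hy, hye,
        zero_smul, add_zero, zero_add, one_smul, zero_apply, smul_eq_zero, he0, or_false,
        inner_self_eq_zero] at h8
      apply hne
      rw [h8]; simp
    constructor
    · rw [h4, map_zero, zero_apply, zero_add] at h1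
      exact h1
    · rw [hM, ContinuousLinearMap.adjoint_inner_left, h4, inner_zero_right]
  -- images orthogonal to `E`
  have horth : ∀ x y, (inner ℂ e x : ℂ) = 0 → (inner ℂ e y : ℂ) = 0 →
      ψ (rankOne ℂ e e) * ψ (rankOne ℂ x y) = 0 ∧ ψ (rankOne ℂ x y) * ψ (rankOne ℂ e e) = 0 := by
    have haux : ∀ x y, (inner ℂ e x : ℂ) = 0 → (inner ℂ e y : ℂ) = 0 → (inner ℂ y x : ℂ) ≠ 0 →
      ψ (rankOne ℂ e e) * ψ (rankOne ℂ x y) = 0 ∧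
        ψ (rankOne ℂ x y) * ψ (rankOne ℂ e e) = 0 := by
      intro x y hx hy hxy
      have hy' : (inner ℂ y e : ℂ) = 0 := inner_eq_zero_symm.1 hy
      have := loc_orth hψ (R := (inner ℂ y x : ℂ)⁻¹ • rankOne ℂ x y) hEE ?_ ?_ ?_
      · simpa [hxy] using this
      · rw [smul_mul_smul_comm, r1_mul, smul_smul]
        congr 1
        field_simp
      · rw [mul_smul_comm, r1_mul, hx]; simp
      · rw [smul_mul_assoc, r1_mul, hy']; simp
    intro x y hx hy
    by_cases hxy : (inner ℂ y x : ℂ) = 0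
    · by_cases hx0 : x = 0
      · subst hx0; simp
      · have hxx : (inner ℂ x x : ℂ) ≠ 0 := inner_self_ne_zero.2 hx0
        have h1 := haux x x hx hx hxx
        have h2 := haux x (y + x) hx (by rw [inner_add_right, hx, hy, add_zero])
          (by rw [inner_add_left, hxy, zero_add]; exact hxx)
        rw [map_add, map_add, mul_add, add_mul, h1.1, h1.2, add_zero, add_zero] at h2
        exact h2
    · exact haux x y hx hy hxy
  have hmain : ∀ x y, (inner ℂ e x : ℂ) = 0 → (inner ℂ e y : ℂ) = 0 →
      ψ (rankOne ℂ x y) = rankOne ℂ (S x) (M y) ∧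
      (inner ℂ (M y) (S x) : ℂ) = inner ℂ y x := by
    intro x y hx hy
    obtain ⟨hn, hfS⟩ := hSx x hx
    obtain ⟨hm, hMe'⟩ := hMy y hy
    obtain ⟨ho1, ho2⟩ := horth x y hx hy
    have hy' : (inner ℂ y e : ℂ) = 0 := inner_eq_zero_symm.1 hy
    set r := ψ (rankOne ℂ x y) with hr
    set c : ℂ := inner ℂ y x with hc
    have hrr : ∀ v, r (r v) = c • r v := by
      intro v
      have : r * r = c • r := loc_sq hψ (by rw [r1_mul])
      exact congrArg (fun T : H →L[ℂ] H => T v) this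
    have hre : r e' = 0 := by
      have := congrArg (fun T : H →L[ℂ] H => T e') ho2
      rw [hE'] at this
      simpa [hfe] using this
    have hfr : ∀ v, (inner ℂ f (r v) : ℂ) = 0 := by
      intro v
      have := congrArg (fun T : H →L[ℂ] H => inner ℂ f (T v)) ho1
      rw [hE'] at this
      simpa [hfe, inner_smul_right] using this
    have hT : rankOne ℂ (e + x) (e + y) =
        rankOne ℂ e e + rankOne ℂ x e + rankOne ℂ e y + rankOne ℂ x y := by
      simp only [map_add, add_apply]; abel
    have htt := loc_sq hψ (a := rankOne ℂ (e + x) (e + y)) (c := 1 + c) (by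
      rw [r1_mul]
      congr 1
      rw [inner_add_left, inner_add_right, inner_add_right, hee, hx, hy', hc]; ring)
    set t := ψ (rankOne ℂ (e + x) (e + y)) with ht
    have htv : ∀ v, t v = (inner ℂ f v : ℂ) • (e' + S x) + (inner ℂ (M y) v : ℂ) • e' + r v := by
      intro v
      rw [ht, hT, map_add, map_add, map_add, hE', hn, hm]
      simp only [add_apply, rankOne_apply, smul_add]
      rfl
    have htt' : ∀ v, t (t v) = (1 + c) • t v := fun v =>
      congrArg (fun T : H →L[ℂ] H => T v) htt
    have hrv0 : ∀ v, (inner ℂ f v : ℂ) = 0 → r v = (inner ℂ (M y) v : ℂ) • S x := by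
      intro v hv
      have h1 := htt' v
      have h2 : t v = (inner ℂ (M y) v : ℂ) • e' + r v := by rw [htv, hv]; simp
      have h3 : t e' = e' + S x := by rw [htv, hfe, hMe', hre]; simp
      have h4 : t (r v) = (inner ℂ (M y) (r v) : ℂ) • e' + c • r v := by
        rw [htv, hfr, hrr]; simp
      rw [h2, map_add, map_smul, h3, h4] at h1
      have h5 := congrArg (fun z => (inner ℂ f z : ℂ)) h1
      simp only [inner_add_right, inner_smul_right, hfe, hfS, hfr, mul_one, mul_zero,
        add_zero] at h5
      have h7 : (inner ℂ (M y) v : ℂ) • S x + c • r v = (1 + c) • r v := by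
        have h8 : (inner ℂ (M y) v : ℂ) • S x + c • r v =
            ((inner ℂ (M y) v : ℂ) • (e' + S x) + ((inner ℂ (M y) (r v) : ℂ) • e' + c • r v))
            - (inner ℂ (M y) v + inner ℂ (M y) (r v) : ℂ) • e' := by module
        rw [h8, h1, h5]; module
      have h9 : (inner ℂ (M y) v : ℂ) • S x = (1 + c) • r v - c • r v := by rw [← h7]; abel
      rw [h9]; module
    have hrv : ∀ v, r v = (inner ℂ (M y) v : ℂ) • S x := by
      intro v
      have h1 := hrv0 (v - (inner ℂ f v : ℂ) • e') (by
        rw [inner_sub_right, inner_smul_right, hfe, mul_one, sub_self])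
      rw [map_sub, map_smul, hre, smul_zero, sub_zero, inner_sub_right, inner_smul_right, hMe',
        mul_zero, sub_zero] at h1
      exact h1
    refine ⟨ContinuousLinearMap.ext hrv, ?_⟩
    have h1 := htt' e'
    have h3 : t e' = e' + S x := by rw [htv, hfe, hMe', hre]; simp
    rw [h3, htv, hrv] at h1
    have h5 := congrArg (fun z => (inner ℂ f z : ℂ)) h1
    simp only [inner_add_right, inner_smul_right, hfe, hfS, hMe', mul_one, mul_zero,
      add_zero, zero_add] at h5
    exact add_left_cancel h5
  have hdec : ∀ x : H, ∃ (a : ℂ) (x' : H), (inner ℂ e x' : ℂ) = 0 ∧ x = a • e + x' := by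
    intro x
    refine ⟨inner ℂ e x, x - (inner ℂ e x : ℂ) • e, ?_, by abel⟩
    rw [inner_sub_right, inner_smul_right, hee, mul_one, sub_self]
  refine ⟨S, M, ?_, ?_⟩
  · intro x y
    obtain ⟨a, x', hx, rfl⟩ := hdec x
    obtain ⟨d, y', hy, rfl⟩ := hdec y
    simp only [map_add, map_smul, add_apply, smul_apply, map_smulₛₗ, hE', hSe, hMe,
      (hSx x' hx).1, (hMy y' hy).1, (hmain x' y' hx hy).1]
  · intro x y
    obtain ⟨a, x', hx, rfl⟩ := hdec x
    obtain ⟨d, y', hy, rfl⟩ := hdec y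
    have hy' : (inner ℂ y' e : ℂ) = 0 := inner_eq_zero_symm.1 hy
    simp only [map_add, map_smul, inner_add_left, inner_add_right, inner_smul_left,
      inner_smul_right, hSe, hMe, hfe, hee, (hSx x' hx).2, (hMy y' hy).2, (hmain x' y' hx hy).2,
      hx, hy']

end LocalBH2

section LocalBH3

set_option linter.unusedSectionVars false

open InnerProductSpace

variable {H : Type*} [NormedAddCommGroup H] [InnerProductSpace ℂ H] [CompleteSpace H]

lemma idem_fix {ψ : (H →L[ℂ] H) →L[ℂ] (H →L[ℂ] H)} (hψ : IsLocal ψ) {S M : H →L[ℂ] H}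
    (h1 : ∀ x y, ψ (rankOne ℂ x y) = rankOne ℂ (S x) (M y))
    (h2 : ∀ x y, (inner ℂ (M y) (S x) : ℂ) = inner ℂ y x)
    {P : H →L[ℂ] H} (hP : P * P = P) {x : H} (hx : P x = x) : ψ P (S x) = S x := by
  by_cases hx0 : x = 0
  · subst hx0; simp
  set y := ContinuousLinearMap.adjoint P x with hy
  have hn : (inner ℂ x x : ℂ) ≠ 0 := inner_self_ne_zero.2 hx0
  have hyv : ∀ v, (inner ℂ y v : ℂ) = inner ℂ x (P v) := fun v => by
    rw [hy, ContinuousLinearMap.adjoint_inner_left]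
  have hyx : (inner ℂ y x : ℂ) = inner ℂ x x := by rw [hyv, hx]
  set R := (inner ℂ x x : ℂ)⁻¹ • rankOne ℂ x y with hR
  have hRR : R * R = R := by
    rw [hR, smul_mul_smul_comm, r1_mul, smul_smul, hyx]
    congr 1
    field_simp
  have hPR : P * R = R := by
    ext v
    simp [hR, rankOne_apply, hx]
  have hRP : R * P = R := by
    ext v
    have : P (P v) = P v := congrArg (fun T : H →L[ℂ] H => T v) hP
    simp [hR, rankOne_apply, hyv, this]
  have h3 := (loc_orth hψ (E := P - R) (R := R) (by
    rw [sub_mul, mul_sub, mul_sub, hP, hPR, hRP, hRR]; simp) hRR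
    (by rw [sub_mul, hPR, hRR, sub_self]) (by rw [mul_sub, hRP, hRR, sub_self])).1
  rw [map_sub, sub_mul, loc_idem hψ hRR] at h3
  have h4 : ψ R (S x) = S x := by
    rw [hR, map_smul, h1, smul_apply, rankOne_apply, h2, hyx, smul_smul, inv_mul_cancel₀ hn,
      one_smul]
  have h5 := congrArg (fun T : H →L[ℂ] H => T (S x)) h3
  simp only [sub_apply, mul_ap, h4, zero_apply] at h5
  exact sub_eq_zero.1 h5

lemma idem_comm {ψ : (H →L[ℂ] H) →L[ℂ] (H →L[ℂ] H)} (hψ : IsLocal ψ) {S M : H →L[ℂ] H}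
    (h1 : ∀ x y, ψ (rankOne ℂ x y) = rankOne ℂ (S x) (M y))
    (h2 : ∀ x y, (inner ℂ (M y) (S x) : ℂ) = inner ℂ y x)
    {P : H →L[ℂ] H} (hP : P * P = P) : ψ P * S = S * P := by
  ext x
  have h3 : P (P x) = P x := congrArg (fun T : H →L[ℂ] H => T x) hP
  have h4 := idem_fix hψ h1 h2 hP (x := P x) h3
  have h5 := idem_fix hψ h1 h2 (P := 1 - P) (by
    rw [sub_mul, mul_sub, mul_sub, hP]; simp) (x := x - P x) (by simp [h3])
  rw [map_sub, loc_one hψ] at h5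
  simp only [map_sub, sub_apply, one_apply_eq_self, h4] at h5
  rw [mul_ap, mul_ap]
  simpa [sub_eq_zero] using h5

lemma exists_unit_shift (A : H →L[ℂ] H) : ∃ c : ℂ, IsUnit (A - c • (1 : H →L[ℂ] H)) := by
  by_contra! h
  have h1 : ∀ c : ℂ, c ∈ spectrum ℂ A := by
    intro c
    rw [spectrum.mem_iff, ← IsUnit.neg_iff, neg_sub, Algebra.algebraMap_eq_smul_one]
    exact h c
  have h2 := (spectrum.isCompact (𝕜 := ℂ) A)
  rw [Set.eq_univ_of_forall h1] at h2
  exact noncompact_univ ℂ h2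

lemma local_aut_BH [TopologicalSpace.SeparableSpace H] (hH : ¬ FiniteDimensional ℂ H)
    {ψ : (H →L[ℂ] H) →L[ℂ] (H →L[ℂ] H)} (hψ : IsLocal ψ) :
    (∀ A B, ψ (A * B) = ψ A * ψ B) ∧ Function.Surjective ψ ∧ ∀ A, ‖A‖ ≤ ‖ψ‖ * ‖ψ A‖ := by
  obtain ⟨S, M, h1, h2⟩ := structure_thm hH hψ
  set L := ContinuousLinearMap.adjoint M with hL
  have hLS : L * S = 1 := by
    ext x
    refine ext_inner_left ℂ (fun y => ?_)
    rw [mul_ap, hL, ContinuousLinearMap.adjoint_inner_right, h2, one_apply_eq_self]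
  set E := 1 - S * L with hE
  have hES : E * S = 0 := by rw [hE, sub_mul, mul_assoc, hLS]; simp
  have hSL : S * L = 1 := by
    let θ : (H →L[ℂ] H) →ₗ[ℂ] (H →L[ℂ] H) := (LinearMap.mulLeft ℂ E).comp ψ.toLinearMap
    have hθ : ∀ A, θ A = E * ψ A := fun A => rfl
    have := theta_zero hH θ (‖E‖ * ‖ψ‖) ?_ ?_ ?_
    · rw [hθ, loc_one hψ, mul_one, hE, sub_eq_zero] at this
      exact this.symm
    · intro P
      rw [hθ, mul_assoc]
      exact (norm_mul_le _ _).trans (by gcongr; exact ψ.le_opNorm P)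
    · intro P hP
      have h3 := idem_comm hψ h1 h2 hP
      have h4 : ψ P * E = ψ P - S * P * L := by rw [hE, mul_sub, ← h3, mul_one, mul_assoc]
      rw [hθ]
      calc E * ψ P * (E * ψ P) = E * (ψ P * E) * ψ P := by simp only [mul_assoc]
        _ = E * (ψ P * ψ P) - (E * S) * (P * L * ψ P) := by rw [h4]; noncomm_ring
        _ = E * ψ P := by rw [hES, loc_idem hψ hP]; simp
    · intro x y
      rw [hθ, h1]
      ext v
      rw [mul_ap, rankOne_apply, map_smul, ← mul_ap, hES]; simp
  have hcomm : ∀ A, ψ A * S = S * A := by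
    intro A
    obtain ⟨c, hc⟩ := exists_unit_shift A
    set B := A - c • (1 : H →L[ℂ] H) with hB
    obtain ⟨u, hu⟩ := loc_unit hψ hc
    have h3 : L * ↑(u⁻¹) * S * B = 1 := by
      rw [← sub_eq_zero]
      have : (((L * ↑(u⁻¹) * S * B - 1 : H →L[ℂ] H)) : H →ₗ[ℂ] H) = 0 := by
        rw [← inner_map_self_eq_zero]
        intro x
        by_cases hx0 : x = 0
        · subst hx0; simp
        have hn : (inner ℂ x x : ℂ) ≠ 0 := inner_self_ne_zero.2 hx0
        obtain ⟨C, hC0, hC⟩ := loc_zd hψ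
          (a := B - (inner ℂ x x : ℂ)⁻¹ • rankOne ℂ (B x) x) (b := rankOne ℂ x x) (by
            ext v
            rw [mul_ap, rankOne_apply, map_smul, sub_apply, smul_apply, rankOne_apply, smul_smul,
              inv_mul_cancel₀ hn]
            simp) (rankOne_ne_zero hx0 hx0)
        obtain ⟨w, hw⟩ : ∃ w, C w ≠ 0 := by
          by_contra! h
          exact hC0 (ContinuousLinearMap.ext h)
        set v := C w with hv
        have h4 := congrArg (fun T : H →L[ℂ] H => T w) hC
        simp only [mul_ap, map_sub, map_smul, h1, sub_apply, smul_apply, rankOne_apply, ← hv,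
          zero_apply, sub_eq_zero, ← hu] at h4
        have h5 : v = ((inner ℂ x x : ℂ)⁻¹ * inner ℂ (M x) v) • (↑(u⁻¹) : H →L[ℂ] H) (S (B x)) := by
          have h6 := congrArg (fun z => (↑(u⁻¹) : H →L[ℂ] H) z) h4
          simp only [map_smul] at h6
          rw [← mul_ap, Units.inv_mul, one_apply_eq_self, smul_smul] at h6
          exact h6
        set q : ℂ := inner ℂ (M x) v with hq
        have hq0 : q ≠ 0 := by
          intro h0
          rw [h0] at h5
          simp at h5
          exact hw h5
        have h6 : q = (inner ℂ x x : ℂ)⁻¹ * q * inner ℂ (M x) ((↑(u⁻¹) : H →L[ℂ] H) (S (B x))) := by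
          conv_lhs => rw [hq, h5, inner_smul_right]
        have h7 : (inner ℂ (M x) ((↑(u⁻¹) : H →L[ℂ] H) (S (B x))) : ℂ) = inner ℂ x x := by
          have h8 : q * inner ℂ x x = q * inner ℂ (M x) ((↑(u⁻¹) : H →L[ℂ] H) (S (B x))) := by
            conv_lhs => rw [h6]
            field_simp
          exact (mul_left_cancel₀ hq0 h8).symm
        rw [← inner_conj_symm]
        simp only [ContinuousLinearMap.coe_coe, sub_apply, mul_ap, one_apply_eq_self,
          inner_sub_right]
        rw [hL, ContinuousLinearMap.adjoint_inner_right, h7]; simp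
      exact ContinuousLinearMap.coe_injective this
    have h4 : S * B = ψ B * S := by
      have h5 : (↑u : H →L[ℂ] H) * (S * (L * ↑(u⁻¹) * S * B)) = S * B := by
        calc _ = (↑u : H →L[ℂ] H) * ((S * L) * (↑(u⁻¹) * (S * B))) := by simp only [mul_assoc]
          _ = S * B := by rw [hSL, one_mul, ← mul_assoc, Units.mul_inv, one_mul]
      rw [h3, mul_one, hu] at h5
      exact h5.symm
    rw [hB, map_sub, map_smul, loc_one hψ, mul_sub, sub_mul] at h4
    simpa using h4.symm
  have hform : ∀ A, ψ A = S * A * L := by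
    intro A
    rw [← hcomm, mul_assoc, hSL, mul_one]
  refine ⟨?_, ?_, ?_⟩
  · intro A B
    rw [hform, hform, hform]
    calc S * (A * B) * L = S * A * 1 * B * L := by simp only [mul_assoc, one_mul]
      _ = _ := by rw [← hLS]; simp only [mul_assoc]
  · intro B
    refine ⟨L * B * S, ?_⟩
    rw [hform]
    calc _ = (S * L) * B * (S * L) := by simp only [mul_assoc]
      _ = B := by rw [hSL]; simp
  · intro A
    refine ContinuousLinearMap.opNorm_le_bound _ (by positivity) (fun x => ?_)
    have key : ∀ y, ‖(inner ℂ y (A x) : ℂ)‖ ≤ ‖ψ‖ * ‖ψ A‖ * ‖x‖ * ‖y‖ := by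
      intro y
      have h3 : (inner ℂ y (A x) : ℂ) = inner ℂ (M y) (ψ A (S x)) := by
        rw [← mul_ap, hcomm, mul_ap, h2]
      have h4 : ‖S x‖ * ‖M y‖ ≤ ‖ψ‖ * (‖x‖ * ‖y‖) := by
        rw [← norm_rankOne (𝕜 := ℂ), ← norm_rankOne (𝕜 := ℂ) x y, ← h1]
        exact ψ.le_opNorm _
      rw [h3]
      calc _ ≤ ‖M y‖ * ‖ψ A (S x)‖ := norm_inner_le_norm _ _
        _ ≤ ‖M y‖ * (‖ψ A‖ * ‖S x‖) := by gcongr; exact (ψ A).le_opNorm _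
        _ = ‖ψ A‖ * (‖S x‖ * ‖M y‖) := by ring
        _ ≤ ‖ψ A‖ * (‖ψ‖ * (‖x‖ * ‖y‖)) := by gcongr
        _ = _ := by ring
    have h5 := key (A x)
    rw [inner_self_eq_norm_sq_to_K] at h5
    by_cases h0 : ‖A x‖ = 0
    · rw [h0]; positivity
    · have hpos : 0 < ‖A x‖ := lt_of_le_of_ne (norm_nonneg _) (Ne.symm h0)
      have h6 : ‖((‖A x‖ : ℂ)) ^ 2‖ = ‖A x‖ * ‖A x‖ := by simp [sq]
      have h7 : ‖A x‖ * ‖A x‖ ≤ ‖ψ‖ * ‖ψ A‖ * ‖x‖ * ‖A x‖ := by rw [← h6]; exact h5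
      exact le_of_mul_le_mul_right h7 hpos

end LocalBH3

section Basics

set_option linter.unusedSectionVars false

open Filter Topology

variable {X : Type*} [TopologicalSpace X]
variable {E F : Type*} [NormedAddCommGroup E] [NormedSpace ℂ E] [NormedAddCommGroup F]
  [NormedSpace ℂ F]

lemma c0_norm_le (f : C₀(X, E)) (x : X) : ‖f x‖ ≤ ‖f‖ := by
  rw [← ZeroAtInftyContinuousMap.norm_toBCF_eq_norm]
  exact f.toBCF.norm_coe_le_norm x

lemma c0_norm_le_of (f : C₀(X, E)) {C : ℝ} (hC : 0 ≤ C) (h : ∀ x, ‖f x‖ ≤ C) : ‖f‖ ≤ C := by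
  rw [← ZeroAtInftyContinuousMap.norm_toBCF_eq_norm]
  exact (BoundedContinuousFunction.norm_le hC).2 h

lemma exists_c0 {k : X → E} (hk : Continuous k) (f : C₀(X, F)) {C : ℝ}
    (h : ∀ x, ‖k x‖ ≤ C * ‖f x‖) : ∃ g : C₀(X, E), ∀ x, g x = k x := by
  refine ⟨⟨⟨k, hk⟩, ?_⟩, fun x => rfl⟩
  have h1 : Tendsto (fun x => C * ‖f x‖) (cocompact X) (𝓝 0) := by
    have := (f.zero_at_infty'.norm).const_mul C
    simpa using this
  exact squeeze_zero_norm h h1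

lemma exists_c0_sqrt {k : X → E} (hk : Continuous k) (f : C₀(X, F))
    (h : ∀ x, ‖k x‖ ≤ Real.sqrt ‖f x‖) : ∃ g : C₀(X, E), ∀ x, g x = k x := by
  refine ⟨⟨⟨k, hk⟩, ?_⟩, fun x => rfl⟩
  have h1 : Tendsto (fun x => Real.sqrt ‖f x‖) (cocompact X) (𝓝 0) := by
    have := (f.zero_at_infty'.norm).sqrt
    simpa using this
  exact squeeze_zero_norm h h1

/-- Postcomposition with a bounded operator. -/
noncomputable def post (L : E →L[ℂ] F) : C₀(X, E) →L[ℂ] C₀(X, F) :=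
  LinearMap.mkContinuous
    { toFun := fun f => ⟨⟨fun x => L (f x), L.continuous.comp f.continuous⟩, by
        have := (L.continuous.tendsto 0).comp f.zero_at_infty'
        rw [map_zero] at this
        exact this⟩
      map_add' := fun f g => by ext x; exact map_add L (f x) (g x)
      map_smul' := fun c f => by ext x; exact map_smul L c (f x) } ‖L‖ (fun f => by
        apply c0_norm_le_of _ (by positivity)
        intro x
        exact (L.le_opNorm _).trans (by gcongr; exact c0_norm_le f x))

@[simp] lemma post_apply (L : E →L[ℂ] F) (f : C₀(X, E)) (x : X) : post L f x = L (f x) := rfl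

/-- Elementary tensors. -/
noncomputable def tens (A : E) : C₀(X, ℂ) →L[ℂ] C₀(X, E) :=
  post (ContinuousLinearMap.toSpanSingleton ℂ A)

@[simp] lemma tens_apply (A : E) (f : C₀(X, ℂ)) (x : X) : tens A f x = f x • A := rfl

/-- Evaluation. -/
noncomputable def evc (x : X) : C₀(X, E) →L[ℂ] E :=
  LinearMap.mkContinuous
    { toFun := fun f => f x
      map_add' := fun f g => rfl
      map_smul' := fun c f => rfl } 1 (fun f => by
        rw [one_mul]; exact c0_norm_le f x)

@[simp] lemma evc_apply (x : X) (f : C₀(X, E)) : evc x f = f x := rfl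

lemma c0_sqrt_factor (g : C₀(X, E)) : ∃ (f : C₀(X, ℂ)) (h : C₀(X, E)),
    (∀ x, g x = f x • h x) ∧ ∀ x, g x = 0 → f x = 0 := by
  have hs : Continuous fun x => Real.sqrt ‖g x‖ := g.continuous.norm.sqrt
  obtain ⟨f, hf⟩ := exists_c0_sqrt (k := fun x => ((Real.sqrt ‖g x‖ : ℝ) : ℂ))
    (Complex.continuous_ofReal.comp hs) g (by
      intro x
      rw [Complex.norm_real, Real.norm_of_nonneg (Real.sqrt_nonneg _)])
  have hn : ∀ x, ‖((((Real.sqrt ‖g x‖ : ℝ) : ℂ))⁻¹ • g x)‖ = Real.sqrt ‖g x‖ := by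
    intro x
    rw [norm_smul, norm_inv, Complex.norm_real, Real.norm_of_nonneg (Real.sqrt_nonneg _)]
    by_cases h0 : g x = 0
    · simp [h0]
    · have h1 : Real.sqrt ‖g x‖ ≠ 0 := by
        rw [Real.sqrt_ne_zero']; exact norm_pos_iff.2 h0
      field_simp
      rw [Real.sq_sqrt (norm_nonneg _)]
  have hc : Continuous fun x => ((((Real.sqrt ‖g x‖ : ℝ) : ℂ))⁻¹ • g x) := by
    rw [continuous_iff_continuousAt]
    intro x
    by_cases h0 : g x = 0
    · have h2 : ((((Real.sqrt ‖g x‖ : ℝ) : ℂ))⁻¹ • g x) = 0 := by simp [h0]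
      rw [ContinuousAt, h2]
      apply squeeze_zero_norm (fun y => (hn y).le)
      have := hs.tendsto x
      simpa [h0] using this
    · have h1 : ((Real.sqrt ‖g x‖ : ℝ) : ℂ) ≠ 0 := by
        rw [Complex.ofReal_ne_zero, Real.sqrt_ne_zero']; exact norm_pos_iff.2 h0
      exact ((Complex.continuous_ofReal.comp hs).continuousAt.inv₀ h1).smul
        g.continuous.continuousAt
  obtain ⟨h, hh⟩ := exists_c0_sqrt hc g (fun x => (hn x).le)
  refine ⟨f, h, ?_, ?_⟩
  · intro x
    rw [hf, hh]
    by_cases h0 : g x = 0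
    · simp [h0]
    · have h1 : ((Real.sqrt ‖g x‖ : ℝ) : ℂ) ≠ 0 := by
        rw [Complex.ofReal_ne_zero, Real.sqrt_ne_zero']; exact norm_pos_iff.2 h0
      rw [smul_smul, mul_inv_cancel₀ h1, one_smul]
  · intro x h0
    rw [hf, h0]; simp

variable [LocallyCompactSpace X] [T2Space X]

lemma bump {p : X} {U : Set X} (hU : U ∈ 𝓝 p) : ∃ (u : C₀(X, ℂ)) (r : X → ℝ),
    (∀ x, u x = (r x : ℂ)) ∧ (∀ x, 0 ≤ r x ∧ r x ≤ 1) ∧ (∀ᶠ x in 𝓝 p, r x = 1) ∧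
    ∀ x, x ∉ U → r x = 0 := by
  obtain ⟨K, hK, hKU, hKc⟩ := local_compact_nhds (isOpen_interior.mem_nhds (mem_interior_iff_mem_nhds.2 hU))
  obtain ⟨f, hf1, hf0, hfs, hf⟩ := exists_continuous_one_zero_of_isCompact hKc
    (isOpen_interior (s := U)).isClosed_compl (by
      rw [Set.disjoint_compl_right_iff_subset]; exact hKU)
  refine ⟨⟨⟨fun x => (f x : ℂ), Complex.continuous_ofReal.comp f.continuous⟩, ?_⟩, f, fun x => rfl,
    fun x => hf x, ?_, ?_⟩
  · have h1 : HasCompactSupport (fun x => (f x : ℂ)) :=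
      hfs.comp_left (g := fun t : ℝ => (t : ℂ)) (by simp)
    exact h1.is_zero_at_infty
  · filter_upwards [hK] with x hx
    exact hf1 hx
  · intro x hx
    exact hf0 (fun h => hx (interior_subset h))

lemma bump' (p : X) : ∃ u : C₀(X, ℂ), u p = 1 := by
  obtain ⟨u, r, h1, -, h2, -⟩ := bump (p := p) univ_mem
  exact ⟨u, by rw [h1, h2.self_of_nhds]; simp⟩

lemma c0_sep {p q : X} (h : ∀ f : C₀(X, ℂ), f p = f q) : p = q := by
  by_contra hne
  obtain ⟨u, r, h1, -, h2, h3⟩ := bump (p := p) (U := {q}ᶜ) (isOpen_compl_singleton.mem_nhds hne)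
  have := h u
  rw [h1, h1, h2.self_of_nhds, h3 q (by simp)] at this
  simp at this

end Basics

section Chars

set_option linter.unusedSectionVars false

open Filter Topology

variable {X : Type*} [TopologicalSpace X] [LocallyCompactSpace X] [T2Space X]

/-- Nonzero characters of `C₀(X)` are point evaluations. -/
lemma char_eval (χ : C₀(X, ℂ) →ₗ[ℂ] ℂ) (hm : ∀ f g, χ (f * g) = χ f * χ g)
    (h0 : ∃ f, χ f ≠ 0) : ∃ p : X, ∀ f, χ f = f p := by
  classical
  obtain ⟨u0, hu0⟩ := h0
  obtain ⟨u, hu⟩ : ∃ u, χ u = 1 := ⟨(χ u0)⁻¹ • u0, by rw [map_smul, smul_eq_mul, inv_mul_cancel₀ hu0]⟩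
  by_cases hp : ∃ p : X, ∀ f, χ f = 0 → f p = 0
  · obtain ⟨p, hp⟩ := hp
    have h1 : ∀ f, f p = χ f * u p := by
      intro f
      have := hp (f - χ f • u) (by rw [map_sub, map_smul, hu]; simp)
      have h2 : f p - χ f * u p = 0 := this
      exact sub_eq_zero.1 h2
    have h2 : u p ≠ 0 → u p = 1 := by
      intro hne
      have h3 := h1 (u * u)
      rw [hm, hu] at h3
      have h4 : u p * u p = 1 * 1 * u p := h3
      have h5 : u p * u p = 1 * u p := by rw [h4]; ring
      exact mul_right_cancel₀ hne h5
    by_cases hne : u p = 0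
    · -- every function vanishes at `p`
      exfalso
      obtain ⟨v, hv⟩ := bump' p
      have h3 := h1 v
      rw [hv, hne, mul_zero] at h3
      exact one_ne_zero h3
    · exact ⟨p, fun f => by rw [h1 f, h2 hne, mul_one]⟩
  exfalso
  push Not at hp
  choose f hf1 hf2 using hp
  have hK : IsCompact {x | (1 / 2 : ℝ) ≤ ‖u x‖} := by
    have h1 : ∀ᶠ x in cocompact X, ‖u x‖ < 1 / 2 := by
      have := u.zero_at_infty'.norm
      rw [norm_zero] at this
      exact this.eventually_lt_const (by norm_num)
    obtain ⟨K, hK, hKs⟩ := mem_cocompact.1 h1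
    refine hK.of_isClosed_subset (isClosed_le continuous_const u.continuous.norm) ?_
    intro x hx
    by_contra hxK
    have h2 : ‖u x‖ < 1 / 2 := hKs hxK
    exact absurd hx (not_le.2 h2)
  obtain ⟨t, ht⟩ := hK.elim_finite_subcover (fun p : X => {x | f p x ≠ 0})
    (fun p => isOpen_ne_fun (f p).continuous continuous_const)
    (fun x _ => Set.mem_iUnion.2 ⟨x, hf2 x⟩)
  set F : C₀(X, ℂ) := ∑ p ∈ t, star (f p) * f p with hF
  have hχF : χ F = 0 := by
    rw [hF, map_sum]
    refine Finset.sum_eq_zero (fun p _ => ?_)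
    rw [hm, hf1, mul_zero]
  let R : X → ℝ := fun x => ∑ p ∈ t, ‖f p x‖ ^ 2
  have hsum : ∀ (s : Finset X) (x : X), (∑ p ∈ s, star (f p) * f p : C₀(X, ℂ)) x =
      ((∑ p ∈ s, ‖f p x‖ ^ 2 : ℝ) : ℂ) := by
    intro s x
    induction s using Finset.induction_on with
    | empty => simp
    | insert a s ha ih =>
      rw [Finset.sum_insert ha, Finset.sum_insert ha, ZeroAtInftyContinuousMap.add_apply, ih]
      push_cast
      congr 1
      exact Complex.conj_mul' (f a x)
  have hFR : ∀ x, F x = (R x : ℂ) := fun x => hsum t x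
  have hRc : Continuous R := continuous_finsetSum _ fun p _ => (f p).continuous.norm.pow 2
  have hR0 : ∀ x, 0 ≤ R x := fun x => Finset.sum_nonneg fun p _ => by positivity
  obtain ⟨δ, hδ, hRδ⟩ : ∃ δ > 0, ∀ x, (1 / 2 : ℝ) ≤ ‖u x‖ → δ ≤ R x := by
    have hpos : ∀ x, (1 / 2 : ℝ) ≤ ‖u x‖ → 0 < R x := by
      intro x hx
      obtain ⟨p, hpt, hpx⟩ := Set.mem_iUnion₂.1 (ht hx)
      refine lt_of_lt_of_le ?_ (Finset.single_le_sum (f := fun p => ‖f p x‖ ^ 2)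
        (fun p _ => by positivity) hpt)
      have : 0 < ‖f p x‖ := norm_pos_iff.2 hpx
      positivity
    by_cases hne : ({x | (1 / 2 : ℝ) ≤ ‖u x‖} : Set X).Nonempty
    · obtain ⟨x0, hx0, hmin⟩ := hK.exists_isMinOn hne hRc.continuousOn
      exact ⟨R x0, hpos x0 hx0, fun x hx => hmin hx⟩
    · exact ⟨1, one_pos, fun x hx => absurd ⟨x, hx⟩ hne⟩
  let m : X → ℝ := fun x => max (R x) δ
  have hm0 : ∀ x, 0 < m x := fun x => lt_max_of_lt_right hδ
  have hmc : Continuous m := hRc.max continuous_const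
  obtain ⟨q, hq⟩ := exists_c0 (k := fun x => ((m x : ℝ) : ℂ)⁻¹ * u x) (f := u) (C := δ⁻¹)
    (((Complex.continuous_ofReal.comp hmc).inv₀ (fun x => by
      simpa using (hm0 x).ne')).mul u.continuous) (by
      intro x
      rw [norm_mul, norm_inv, Complex.norm_real, Real.norm_of_nonneg (hm0 x).le]
      gcongr
      exact le_max_right _ _)
  set w := u - F * q with hw
  have hχw : χ w = 1 := by rw [hw, map_sub, hm, hχF, hu]; simp
  have hwn : ∀ x, ‖w x‖ ≤ 1 / 2 := by
    intro x
    have h1 : w x = ((1 - R x / m x : ℝ) : ℂ) * u x := by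
      have h2 : w x = u x - F x * q x := rfl
      rw [h2, hq, hFR]; push_cast; ring
    by_cases hx : (1 / 2 : ℝ) ≤ ‖u x‖
    · have h2 : m x = R x := max_eq_left (hRδ x hx)
      have h3 : R x ≠ 0 := by rw [← h2]; exact (hm0 x).ne'
      rw [h1, h2, div_self h3]; norm_num
    · have h2 : R x / m x ≤ 1 := div_le_one_of_le₀ (le_max_left _ _) (hm0 x).le
      have h3 : 0 ≤ R x / m x := div_nonneg (hR0 x) (hm0 x).le
      rw [h1, norm_mul, Complex.norm_real, Real.norm_of_nonneg (by linarith)]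
      calc (1 - R x / m x) * ‖u x‖ ≤ 1 * ‖u x‖ := by gcongr; linarith
        _ ≤ 1 / 2 := by rw [one_mul]; exact (not_le.1 hx).le
  have hw1 : ∀ x, (1 / 2 : ℝ) ≤ ‖1 - w x‖ := by
    intro x
    have h1 := norm_sub_norm_le (1 : ℂ) (w x)
    rw [norm_one] at h1
    linarith [hwn x]
  have hw2 : ∀ x, 1 - w x ≠ 0 := by
    intro x h1
    have := hw1 x
    rw [h1, norm_zero] at this
    linarith
  obtain ⟨g, hg⟩ := exists_c0 (k := fun x => (1 - w x)⁻¹ * w x) (f := w) (C := 2)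
    (((continuous_const.sub w.continuous).inv₀ hw2).mul w.continuous) (by
      intro x
      rw [norm_mul, norm_inv]
      gcongr
      rw [inv_le_comm₀ (lt_of_lt_of_le (by norm_num) (hw1 x)) (by norm_num)]
      have := hw1 x
      linarith)
  have hgw : g = w + w * g := by
    ext x
    have h1 : (w + w * g) x = w x + w x * g x := rfl
    rw [h1, hg]
    have := hw2 x
    field_simp
    ring
  have h1 := congrArg χ hgw
  rw [map_add, hm, hχw, one_mul] at h1
  have : (1 : ℂ) = 0 := by
    have h2 : (1 : ℂ) = (1 + χ g) - χ g := by ring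
    rw [h2, ← h1, sub_self]
  exact one_ne_zero this

lemma aut_symm {A : Type*} [NonUnitalNonAssocSemiring A] [Module ℂ A] {T : A → A}
    (hT : IsAlgebraAutomorphism T) : ∃ T' : A → A, IsAlgebraAutomorphism T' ∧
      (∀ a, T (T' a) = a) ∧ ∀ a, T' (T a) = a := by
  let e := Equiv.ofBijective T hT.2.2
  have h1 : ∀ a, T (e.symm a) = a := fun a => e.apply_symm_apply a
  have h2 : ∀ a, e.symm (T a) = a := fun a => e.symm_apply_apply a
  refine ⟨e.symm, ⟨⟨?_, ?_⟩, ?_, e.symm.bijective⟩, h1, h2⟩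
  · intro a b
    apply hT.2.2.1
    rw [hT.1.map_add, h1, h1, h1]
  · intro c a
    apply hT.2.2.1
    rw [hT.1.map_smul, h1, h1]
  · intro a b
    apply hT.2.2.1
    rw [hT.2.1, h1, h1, h1]

lemma aut_point {T : C₀(X, ℂ) → C₀(X, ℂ)} (hT : IsAlgebraAutomorphism T) (x : X) :
    ∃ y : X, ∀ f, T f x = f y := by
  let χ : C₀(X, ℂ) →ₗ[ℂ] ℂ := (evc x).toLinearMap.comp (hT.1.mk' T)
  have hχ : ∀ f, χ f = T f x := fun f => rfl
  obtain ⟨y, hy⟩ := char_eval χ (fun f g => by rw [hχ, hχ, hχ, hT.2.1]; rfl) (by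
    obtain ⟨u, hu⟩ := bump' x
    obtain ⟨f, rfl⟩ := hT.2.2.2 u
    exact ⟨f, by rw [hχ, hu]; exact one_ne_zero⟩)
  exact ⟨y, hy⟩

lemma aut_homeo {T : C₀(X, ℂ) → C₀(X, ℂ)} (hT : IsAlgebraAutomorphism T) :
    ∃ φ : X ≃ₜ X, ∀ f x, T f x = f (φ x) := by
  have hcont : ∀ {T : C₀(X, ℂ) → C₀(X, ℂ)} {φ : X → X}, (∀ x f, T f x = f (φ x)) →
      Continuous φ := by
    intro T φ h
    rw [continuous_iff_continuousAt]
    intro x U hU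
    obtain ⟨u, r, h1, -, h2, h3⟩ := bump hU
    have h4 : ∀ᶠ y in 𝓝 x, T u y ≠ 0 := by
      refine (map_continuous (T u)).continuousAt.eventually_ne ?_
      rw [h, h1, h2.self_of_nhds]; simp
    rw [mem_map]
    filter_upwards [h4] with y hy
    by_contra hyU
    apply hy
    rw [h, h1, h3 _ hyU]; simp
  obtain ⟨T', hT', h1, h2⟩ := aut_symm hT
  choose φ hφ using aut_point hT
  choose φ' hφ' using aut_point hT'
  refine ⟨⟨⟨φ, φ', ?_, ?_⟩, hcont hφ, hcont hφ'⟩, fun f x => hφ x f⟩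
  · intro x
    apply c0_sep
    intro f
    rw [← hφ', ← hφ, h1]
  · intro x
    apply c0_sep
    intro f
    rw [← hφ, ← hφ', h2]

end Chars

section Fibers

set_option linter.unusedSectionVars false

open Filter Topology InnerProductSpace

variable {X : Type*} [TopologicalSpace X] [LocallyCompactSpace X] [T2Space X]
variable {H : Type*} [NormedAddCommGroup H] [InnerProductSpace ℂ H] [CompleteSpace H]

/-- The vector state `A ↦ ⟨e, A e⟩`. -/
noncomputable def vec (e : H) : (H →L[ℂ] H) →L[ℂ] ℂ :=
  (innerSL ℂ e).comp (ContinuousLinearMap.apply ℂ H e)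

lemma vec_apply (e : H) (A : H →L[ℂ] H) : vec e A = inner ℂ e (A e) := rfl

lemma vec_one {e : H} (he : ‖e‖ = 1) : vec e 1 = 1 := by
  rw [vec_apply, one_apply_eq_self, inner_self_eq_norm_sq_to_K, he]; simp

lemma scalar_of_comm {e : H} (he : ‖e‖ = 1) {A : H →L[ℂ] H} (h : ∀ B, A * B = B * A) :
    A = vec e A • (1 : H →L[ℂ] H) := by
  ext x
  have h1 := congrArg (fun T : H →L[ℂ] H => T e) (h (rankOne ℂ x e))
  simp only [mul_ap, rankOne_apply, map_smul] at h1
  rw [inner_self_eq_norm_sq_to_K, he] at h1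
  simpa [vec_apply] using h1

lemma c0_mul_apply (f g : C₀(X, H →L[ℂ] H)) (x : X) : (f * g) x = f x * g x := rfl

lemma tens_central (f : C₀(X, ℂ)) (g : C₀(X, H →L[ℂ] H)) :
    tens 1 f * g = g * tens 1 f := by
  ext1 x
  rw [c0_mul_apply, c0_mul_apply, tens_apply, smul_mul_assoc, one_mul, mul_smul_comm, mul_one]

lemma central_form {e : H} (he : ‖e‖ = 1) {G : C₀(X, H →L[ℂ] H)} (h : ∀ g, G * g = g * G) :
    G = tens 1 (post (vec e) G) := by
  ext1 x
  rw [tens_apply, post_apply]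
  apply scalar_of_comm he
  intro B
  obtain ⟨u, hu⟩ := bump' x
  have := congrArg (fun F : C₀(X, H →L[ℂ] H) => F x) (h (tens B u))
  simpa [c0_mul_apply, hu] using this

lemma aut_tens {e : H} (he : ‖e‖ = 1) {S : C₀(X, H →L[ℂ] H) → C₀(X, H →L[ℂ] H)}
    (hS : IsAlgebraAutomorphism S) (f : C₀(X, ℂ)) :
    S (tens 1 f) = tens 1 (post (vec e) (S (tens 1 f))) := by
  apply central_form he
  intro g
  obtain ⟨g, rfl⟩ := hS.2.2.2 g
  rw [← hS.2.1, ← hS.2.1, tens_central]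

lemma tens_one_inj {e : H} (he : ‖e‖ = 1) (f : C₀(X, ℂ)) :
    post (vec e) (tens 1 f) = f := by
  ext x
  rw [post_apply, tens_apply, map_smul, vec_one he]; simp

lemma tens_one_mul (f g : C₀(X, ℂ)) :
    tens (1 : H →L[ℂ] H) (f * g) = tens 1 f * tens 1 g := by
  ext1 x
  rw [c0_mul_apply, tens_apply, tens_apply, tens_apply, smul_mul_smul_comm, one_mul]; rfl

/-- An automorphism of `C₀(X, B(H))` restricts to an automorphism of the center. -/
lemma center_aut {e : H} (he : ‖e‖ = 1) {S : C₀(X, H →L[ℂ] H) → C₀(X, H →L[ℂ] H)}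
    (hS : IsAlgebraAutomorphism S) :
    IsAlgebraAutomorphism (fun f : C₀(X, ℂ) => post (vec e) (S (tens 1 f))) := by
  have hmap : ∀ {S : C₀(X, H →L[ℂ] H) → C₀(X, H →L[ℂ] H)} (hS : IsAlgebraAutomorphism S) f g,
      post (vec e) (S (tens 1 f)) = g ↔ S (tens 1 f) = tens 1 g := by
    intro S hS f g
    constructor
    · rintro rfl; exact aut_tens he hS f
    · intro h; rw [h, tens_one_inj he]
  obtain ⟨S', hS', h1, h2⟩ := aut_symm hS
  refine ⟨⟨?_, ?_⟩, ?_, ?_, ?_⟩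
  · intro f g
    simp only [map_add, hS.1.map_add]
  · intro c f
    simp only [map_smul, hS.1.map_smul]
  · intro f g
    rw [hmap hS, tens_one_mul, hS.2.1, tens_one_mul, ← aut_tens he hS, ← aut_tens he hS]
  · intro f g hfg
    have h3 : S (tens 1 f) = S (tens 1 g) := by
      rw [aut_tens he hS f, aut_tens he hS g]
      exact congrArg _ hfg
    have h4 := congrArg (post (vec e)) (hS.2.2.1 h3)
    rwa [tens_one_inj he, tens_one_inj he] at h4
  · intro g
    refine ⟨post (vec e) (S' (tens 1 g)), ?_⟩
    beta_reduce
    rw [hmap hS, ← aut_tens he hS', h1]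

lemma fiber_point {e : H} (he : ‖e‖ = 1) {S : C₀(X, H →L[ℂ] H) → C₀(X, H →L[ℂ] H)}
    (hS : IsAlgebraAutomorphism S) (x : X) :
    ∃ y : X, (∀ f, S (tens 1 f) x = f y • (1 : H →L[ℂ] H)) ∧ ∀ g h, g y = h y → S g x = S h x := by
  obtain ⟨y, hy⟩ := aut_point (center_aut he hS) x
  have h1 : ∀ f, S (tens 1 f) x = f y • (1 : H →L[ℂ] H) := by
    intro f
    rw [aut_tens he hS f, tens_apply, hy]
  have h2 : ∀ g, g y = 0 → S g x = 0 := by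
    intro g hg
    obtain ⟨f, h, hfh, hf⟩ := c0_sqrt_factor g
    have h3 : g = tens 1 f * h := by
      ext1 z
      rw [c0_mul_apply, tens_apply, smul_mul_assoc, one_mul, hfh]
    rw [h3, hS.2.1, c0_mul_apply, h1, hf y hg]; simp
  refine ⟨y, h1, ?_⟩
  intro g h hgh
  have h3 := h2 (g - h) (by
    have : (g - h) y = g y - h y := rfl
    rw [this, hgh, sub_self])
  have h4 : S (g - h) = S g - S h := hS.1.map_sub g h
  rw [h4] at h3
  exact sub_eq_zero.1 h3

/-- Fiberwise description of automorphisms of `C₀(X, B(H))`. -/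
lemma fiber_aut {e : H} (he : ‖e‖ = 1) {S : C₀(X, H →L[ℂ] H) → C₀(X, H →L[ℂ] H)}
    (hS : IsAlgebraAutomorphism S) (x : X) :
    ∃ (y : X) (τ : (H →L[ℂ] H) → (H →L[ℂ] H)), IsAlgebraAutomorphism τ ∧
      ∀ g, S g x = τ (g y) := by
  obtain ⟨S', hS', h1, h2⟩ := aut_symm hS
  obtain ⟨y, hy1, hy2⟩ := fiber_point he hS x
  obtain ⟨x', hx1, hx2⟩ := fiber_point he hS' y
  have hone : (1 : H →L[ℂ] H) ≠ 0 := by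
    intro h0
    have := vec_one he
    rw [h0, map_zero] at this
    exact zero_ne_one this
  have hxx : x = x' := by
    apply c0_sep
    intro f
    have h3 : S (S' (tens 1 f)) x = f x' • (1 : H →L[ℂ] H) := by
      obtain ⟨u, hu⟩ := bump' y
      rw [hy2 _ (tens 1 (f x' • u)) (by
        rw [hx1, tens_apply]
        have : (f x' • u) y = f x' * u y := rfl
        rw [this, hu, mul_one]), hy1]
      have : (f x' • u) y = f x' * u y := rfl
      rw [this, hu, mul_one]
    rw [h1, tens_apply] at h3
    exact smul_left_injective ℂ hone h3
  subst hxx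
  obtain ⟨u, hu⟩ := bump' y
  have hτ : ∀ g, S g x = S (tens (g y) u) x := by
    intro g
    apply hy2
    rw [tens_apply, hu, one_smul]
  refine ⟨y, fun A => S (tens A u) x, ⟨⟨?_, ?_⟩, ?_, ?_, ?_⟩, hτ⟩
  · intro A B
    rw [hy2 _ (tens A u + tens B u) (by
      have : (tens A u + tens B u) y = tens A u y + tens B u y := rfl
      rw [this]; simp [hu]), hS.1.map_add]
    rfl
  · intro c A
    rw [hy2 _ (c • tens A u) (by
      have : (c • tens A u) y = c • tens A u y := rfl
      rw [this]; simp [hu]), hS.1.map_smul]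
    rfl
  · intro A B
    beta_reduce
    rw [hy2 _ (tens A u * tens B u) (by
      rw [c0_mul_apply]; simp [hu]), hS.2.1]
    rfl
  · intro A B hAB
    have h3 := hx2 (S (tens A u)) (S (tens B u)) hAB
    rw [h2, h2] at h3
    simpa [hu] using h3
  · intro B
    obtain ⟨v, hv⟩ := bump' x
    obtain ⟨g, hg⟩ := hS.2.2.2 (tens B v)
    refine ⟨g y, ?_⟩
    beta_reduce
    rw [← hτ, hg, tens_apply, hv, one_smul]

end Fibers

section MainPart

set_option linter.unusedSectionVars false

open Filter Topology

variable {X : Type*} [TopologicalSpace X] [LocallyCompactSpace X] [T2Space X]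
variable {H : Type*} [NormedAddCommGroup H] [InnerProductSpace ℂ H] [CompleteSpace H]

lemma not_unit_smul [Nontrivial H] {A : H →L[ℂ] H} (h : ¬ IsUnit A) (c : ℂ) : ¬ IsUnit (c • A) := by
  by_cases hc : c = 0
  · rw [hc, zero_smul]; exact not_isUnit_zero
  · intro hu
    apply h
    have h1 : A = (c⁻¹ • (1 : H →L[ℂ] H)) * (c • A) := by
      rw [smul_mul_smul_comm, inv_mul_cancel₀ hc, one_mul, one_smul]
    rw [h1]
    refine IsUnit.mul ⟨⟨c⁻¹ • 1, c • 1, ?_, ?_⟩, rfl⟩ hu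
    · rw [smul_mul_smul_comm, inv_mul_cancel₀ hc, one_mul, one_smul]
    · rw [smul_mul_smul_comm, mul_inv_cancel₀ hc, one_mul, one_smul]

lemma aut_shift {τ : (H →L[ℂ] H) → (H →L[ℂ] H)} (hτ : IsAlgebraAutomorphism τ) (c : ℂ)
    (A : H →L[ℂ] H) : τ (c • (1 : H →L[ℂ] H) - A) = c • (1 : H →L[ℂ] H) - τ A := by
  have h1 : τ (c • (1 : H →L[ℂ] H) - A) = τ (c • (1 : H →L[ℂ] H)) - τ A := hτ.1.map_sub _ _
  rw [h1, hτ.1.map_smul, aut_one hτ]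

lemma mem_spec {c : ℂ} {A : H →L[ℂ] H} :
    c ∈ spectrum ℂ A ↔ ¬ IsUnit (c • (1 : H →L[ℂ] H) - A) := by
  rw [spectrum.mem_iff, Algebra.algebraMap_eq_smul_one]

lemma aut_spec {τ : (H →L[ℂ] H) → (H →L[ℂ] H)} (hτ : IsAlgebraAutomorphism τ) {c : ℂ}
    {A : H →L[ℂ] H} : c ∈ spectrum ℂ (τ A) ↔ c ∈ spectrum ℂ A := by
  rw [mem_spec, mem_spec, ← aut_shift hτ, aut_isUnit hτ]

variable {Φ : C₀(X, H →L[ℂ] H) →L[ℂ] C₀(X, H →L[ℂ] H)} {x p : X}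

lemma vanish_near [Nontrivial H] (hloc : ∀ g, ∃ (y : X) (τ : (H →L[ℂ] H) → (H →L[ℂ] H)),
      IsAlgebraAutomorphism τ ∧ Φ g x = τ (g y))
    (hc : ∀ f, Φ (tens 1 f) x = f p • (1 : H →L[ℂ] H)) {g : C₀(X, H →L[ℂ] H)}
    (hg : ∀ᶠ z in 𝓝 p, g z = 0) : Φ g x = 0 := by
  obtain ⟨f, r, hf, hr, hr1, hr0⟩ := bump hg
  obtain ⟨s, hs⟩ := spectrum.nonempty (Φ g x)
  have hone : (1 : H →L[ℂ] H) ≠ 0 := one_ne_zero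
  have key : ∀ c : ℂ, ‖g‖ + ‖s‖ < ‖c‖ →
      ∃ t : ℝ, Φ g x = (c * (t : ℂ)) • (1 : H →L[ℂ] H) := by
    intro c hcn
    obtain ⟨y, τ, hτ, h1⟩ := hloc (g + c • tens 1 f)
    have h2 : Φ (g + c • tens 1 f) x = Φ g x + c • (1 : H →L[ℂ] H) := by
      have h3 : (Φ g + c • Φ (tens 1 f)) x = Φ g x + c • Φ (tens 1 f) x := rfl
      rw [map_add, map_smul, h3, hc, hf, hr1.self_of_nhds]; simp
    have h4 : (g + c • tens 1 f : C₀(X, H →L[ℂ] H)) y = g y + c • (f y • (1 : H →L[ℂ] H)) := rfl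
    rw [h2, h4] at h1
    by_cases hgy : g y = 0
    · refine ⟨r y - 1, ?_⟩
      rw [hgy, zero_add, hf, smul_smul, hτ.1.map_smul, aut_one hτ] at h1
      have h5 : Φ g x = (Φ g x + c • (1 : H →L[ℂ] H)) - c • (1 : H →L[ℂ] H) := by abel
      rw [h5, h1]; push_cast; module
    · exfalso
      rw [hf, hr0 y hgy] at h1
      simp only [Complex.ofReal_zero, zero_smul, smul_zero, add_zero] at h1
      have h5 : s + c ∈ spectrum ℂ (Φ g x + c • (1 : H →L[ℂ] H)) := by
        rw [mem_spec] at hs ⊢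
        convert hs using 2
        module
      rw [h1, aut_spec hτ] at h5
      have h6 := spectrum.norm_le_norm_of_mem h5
      have h7 := c0_norm_le g y
      have h8 : ‖c‖ ≤ ‖s + c‖ + ‖s‖ := by
        calc ‖c‖ = ‖(s + c) - s‖ := by ring_nf
          _ ≤ _ := norm_sub_le _ _
      linarith
  set C : ℝ := ‖g‖ + ‖s‖ + 1 with hC
  have hC0 : 0 < C := by positivity
  obtain ⟨t1, ht1⟩ := key (C : ℂ) (by
    rw [Complex.norm_real, Real.norm_of_nonneg hC0.le]; linarith)
  obtain ⟨t2, ht2⟩ := key (Complex.I * (C : ℂ)) (by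
    rw [norm_mul, Complex.norm_I, Complex.norm_real, Real.norm_of_nonneg hC0.le]; linarith)
  have h3 : (C : ℂ) * t1 = Complex.I * C * t2 := smul_left_injective ℂ hone (ht1.symm.trans ht2)
  have h4 := congrArg Complex.re h3
  simp at h4
  rw [ht1]
  rcases h4 with h4 | h4
  · exact absurd h4 hC0.ne'
  · rw [h4]; simp

lemma vanish_at [Nontrivial H] (hloc : ∀ g, ∃ (y : X) (τ : (H →L[ℂ] H) → (H →L[ℂ] H)),
      IsAlgebraAutomorphism τ ∧ Φ g x = τ (g y))
    (hc : ∀ f, Φ (tens 1 f) x = f p • (1 : H →L[ℂ] H)) {g : C₀(X, H →L[ℂ] H)}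
    (hg : g p = 0) : Φ g x = 0 := by
  by_contra hne
  have hpos : 0 < ‖Φ g x‖ := norm_pos_iff.2 hne
  set ε := ‖Φ g x‖ / (2 * (‖Φ‖ + 1)) with hε
  have hε0 : 0 < ε := by positivity
  have hU : ∀ᶠ z in 𝓝 p, ‖g z‖ < ε := by
    have := (map_continuous g).norm.tendsto p
    rw [hg, norm_zero] at this
    exact this.eventually_lt_const hε0
  obtain ⟨f, r, hf, hr, hr1, hr0⟩ := bump hU
  set k := tens 1 f * g with hk
  have hkz : ∀ z, k z = f z • g z := by
    intro z
    rw [hk, c0_mul_apply, tens_apply, smul_mul_assoc, one_mul]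
  have h1 : Φ (g - k) x = 0 := by
    apply vanish_near hloc hc
    filter_upwards [hr1] with z hz
    have h2 : (g - k) z = g z - k z := rfl
    rw [h2, hkz, hf, hz]; simp
  have h2 : Φ g x = Φ k x := by
    have h3 : Φ (g - k) x = Φ g x - Φ k x := by rw [map_sub]; rfl
    rw [h3] at h1
    exact sub_eq_zero.1 h1
  have h3 : ‖k‖ ≤ ε := by
    apply c0_norm_le_of _ hε0.le
    intro z
    rw [hkz, norm_smul, hf, Complex.norm_real, Real.norm_of_nonneg (hr z).1]
    by_cases hz : ‖g z‖ < ε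
    · calc r z * ‖g z‖ ≤ 1 * ‖g z‖ := by gcongr; exact (hr z).2
        _ ≤ ε := by rw [one_mul]; exact hz.le
    · rw [hr0 z hz, zero_mul]; exact hε0.le
  have h4 : ‖Φ g x‖ ≤ ‖Φ‖ * ε := by
    rw [h2]
    exact (c0_norm_le _ _).trans ((Φ.le_opNorm k).trans (by gcongr))
  have h5 : ε * (2 * (‖Φ‖ + 1)) = ‖Φ g x‖ := by rw [hε]; field_simp
  nlinarith [norm_nonneg Φ]

lemma fiber_local [Nontrivial H] (hloc : ∀ g, ∃ (y : X) (τ : (H →L[ℂ] H) → (H →L[ℂ] H)),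
      IsAlgebraAutomorphism τ ∧ Φ g x = τ (g y))
    (hc : ∀ f, Φ (tens 1 f) x = f p • (1 : H →L[ℂ] H)) :
    ∃ ψ : (H →L[ℂ] H) →L[ℂ] (H →L[ℂ] H), IsLocal ψ ∧ ‖ψ‖ ≤ ‖Φ‖ ∧ ∀ g, Φ g x = ψ (g p) := by
  obtain ⟨u, r, hu, hr, hr1, -⟩ := bump (p := p) univ_mem
  have hup : u p = 1 := by rw [hu, hr1.self_of_nhds]; simp
  have hev : ∀ g h : C₀(X, H →L[ℂ] H), g p = h p → Φ g x = Φ h x := by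
    intro g h hgh
    have h1 := vanish_at hloc hc (g := g - h) (by
      have : (g - h) p = g p - h p := rfl
      rw [this, hgh, sub_self])
    have h3 : Φ (g - h) x = Φ g x - Φ h x := by rw [map_sub]; rfl
    rw [h3] at h1
    exact sub_eq_zero.1 h1
  let ψ : (H →L[ℂ] H) →L[ℂ] (H →L[ℂ] H) := LinearMap.mkContinuous
    { toFun := fun A => Φ (tens A u) x
      map_add' := fun A B => by
        have : tens (A + B) u = tens A u + tens B u := by
          ext1 z
          exact smul_add (u z) A B
        rw [this, map_add]; rfl
      map_smul' := fun c A => by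
        have : tens (c • A) u = c • tens A u := by
          ext1 z
          exact smul_comm (u z) c A
        rw [this, map_smul]; rfl } ‖Φ‖ (fun A => by
          refine (c0_norm_le _ _).trans ((Φ.le_opNorm _).trans ?_)
          gcongr
          apply c0_norm_le_of _ (norm_nonneg _)
          intro z
          rw [tens_apply, norm_smul, hu, Complex.norm_real, Real.norm_of_nonneg (hr z).1]
          calc r z * ‖A‖ ≤ 1 * ‖A‖ := by gcongr; exact (hr z).2
            _ = ‖A‖ := one_mul _)
  have hψ : ∀ A, ψ A = Φ (tens A u) x := fun A => rfl
  have hψ1 : ψ 1 = 1 := by rw [hψ, hc, hup, one_smul]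
  have hψτ : ∀ A, ∃ (c : ℝ) (τ : (H →L[ℂ] H) → (H →L[ℂ] H)), 0 ≤ c ∧ c ≤ 1 ∧
      IsAlgebraAutomorphism τ ∧ ψ A = τ ((c : ℂ) • A) := by
    intro A
    obtain ⟨y, τ, hτ, h1⟩ := hloc (tens A u)
    refine ⟨r y, τ, (hr y).1, (hr y).2, hτ, ?_⟩
    rw [hψ, h1, tens_apply, hu]
  have hsp : ∀ (A : H →L[ℂ] H) (m : ℂ), m ∈ spectrum ℂ A → m ∈ spectrum ℂ (ψ A) := by
    intro A m hm
    rw [mem_spec] at hm ⊢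
    obtain ⟨c, τ, -, -, hτ, h1⟩ := hψτ (m • (1 : H →L[ℂ] H) - A)
    rw [map_sub, map_smul, hψ1] at h1
    rw [h1, aut_isUnit hτ]
    exact not_unit_smul hm _
  refine ⟨ψ, ?_, LinearMap.mkContinuous_norm_le _ (norm_nonneg Φ) _, ?_⟩
  · intro A
    obtain ⟨a, ha⟩ := spectrum.nonempty A
    set B := A + (1 - a) • (1 : H →L[ℂ] H) with hB
    have h1B : (1 : ℂ) ∈ spectrum ℂ B := by
      rw [mem_spec] at ha ⊢
      convert ha using 2
      rw [hB]; module
    obtain ⟨m, hm, hmax⟩ := (spectrum.isCompact (𝕜 := ℂ) B).exists_isMaxOn ⟨1, h1B⟩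
      continuous_norm.continuousOn
    have hm1 : 1 ≤ ‖m‖ := by
      have := hmax h1B
      simpa using this
    obtain ⟨c, τ, hc0, hc1, hτ, h1⟩ := hψτ B
    have h2 := hsp B m hm
    rw [h1, aut_spec hτ] at h2
    have hc1' : c = 1 := by
      rcases hc0.eq_or_lt with h0 | hpos
      · exfalso
        rw [← h0, Complex.ofReal_zero, zero_smul, spectrum.zero_eq, Set.mem_singleton_iff] at h2
        rw [h2, norm_zero] at hm1
        linarith
      · have hcc : (c : ℂ) ≠ 0 := by simpa using hpos.ne'
        have h3 : m / c ∈ spectrum ℂ B := by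
          rw [mem_spec] at h2 ⊢
          intro h4
          apply not_unit_smul h2 ((c : ℂ)⁻¹)
          convert h4 using 1
          rw [smul_sub, smul_smul, smul_smul, inv_mul_cancel₀ hcc, one_smul]
          congr 2
          field_simp
        have h4 : ‖m / c‖ ≤ ‖m‖ := hmax h3
        rw [norm_div, Complex.norm_real, Real.norm_of_nonneg hpos.le, div_le_iff₀ hpos] at h4
        nlinarith
    refine ⟨τ, hτ, ?_⟩
    rw [hc1', Complex.ofReal_one, one_smul, hB, map_add, map_smul, hψ1, hτ.1.map_add,
      hτ.1.map_smul, aut_one hτ] at h1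
    exact add_right_cancel h1
  · intro g
    rw [hψ]
    apply hev
    rw [tens_apply, hup, one_smul]

end MainPart

end AutRefl

/-- If the automorphism group of `C₀(X)` is algebraically reflexive,
then so is the automorphism group of `C₀(X, B(H))`. -/
theorem aut_reflexive_of_C0_BH_of_aut_reflexive_C0
    {H : Type*} [NormedAddCommGroup H] [InnerProductSpace ℂ H] [CompleteSpace H]
    [TopologicalSpace.SeparableSpace H] (hH : ¬ FiniteDimensional ℂ H)
    {X : Type*} [TopologicalSpace X] [LocallyCompactSpace X] [T2Space X]
    (hrefl : ∀ T : C₀(X, ℂ) →L[ℂ] C₀(X, ℂ),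
      (∀ f : C₀(X, ℂ), ∃ S : C₀(X, ℂ) → C₀(X, ℂ), IsAlgebraAutomorphism S ∧ T f = S f) →
      IsAlgebraAutomorphism (⇑T))
    (Φ : C₀(X, H →L[ℂ] H) →L[ℂ] C₀(X, H →L[ℂ] H))
    (hΦ : ∀ f : C₀(X, H →L[ℂ] H), ∃ S : C₀(X, H →L[ℂ] H) → C₀(X, H →L[ℂ] H),
      IsAlgebraAutomorphism S ∧ Φ f = S f) :
    IsAlgebraAutomorphism (⇑Φ) := by
  open AutRefl Filter Topology in
  obtain ⟨b⟩ := exists_basis hH ℕ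
  have he : ‖b 0‖ = 1 := b.orthonormal.1 0
  set e := b 0 with hedef
  have hnt : Nontrivial H := ⟨e, 0, fun h => by rw [h, norm_zero] at he; exact zero_ne_one he⟩
  obtain ⟨φ, hφ⟩ := aut_homeo (hrefl ((post (vec e)).comp (Φ.comp (tens 1))) (by
    intro f
    obtain ⟨S, hS, h1⟩ := hΦ (tens 1 f)
    refine ⟨_, center_aut he hS, ?_⟩
    change post (vec e) (Φ (tens 1 f)) = _
    rw [h1]))
  have hc : ∀ x f, Φ (tens 1 f) x = f (φ x) • (1 : H →L[ℂ] H) := by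
    intro x f
    obtain ⟨S, hS, h1⟩ := hΦ (tens 1 f)
    have h2 : post (vec e) (Φ (tens 1 f)) x = f (φ x) := hφ f x
    rw [← h2, h1]
    conv_lhs => rw [aut_tens he hS f]
    rfl
  have hfib : ∀ x, ∃ ψ : (H →L[ℂ] H) →L[ℂ] (H →L[ℂ] H), IsLocal ψ ∧ ‖ψ‖ ≤ ‖Φ‖ ∧
      ∀ g, Φ g x = ψ (g (φ x)) := by
    intro x
    refine fiber_local ?_ (hc x)
    intro g
    obtain ⟨S, hS, h1⟩ := hΦ g
    obtain ⟨y, τ, hτ, h2⟩ := fiber_aut he hS x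
    exact ⟨y, τ, hτ, by rw [h1, h2]⟩
  choose ψ hψl hψn hψ using hfib
  have hmul := fun x => (local_aut_BH hH (hψl x)).1
  have hsurj := fun x => (local_aut_BH hH (hψl x)).2.1
  have hbd : ∀ x A, ‖A‖ ≤ ‖Φ‖ * ‖ψ x A‖ := fun x A =>
    ((local_aut_BH hH (hψl x)).2.2 A).trans (by gcongr; exact hψn x)
  refine ⟨Φ.toLinearMap.isLinear, ?_, ?_, ?_⟩
  · intro f g
    ext1 x
    rw [hψ, c0_mul_apply, c0_mul_apply, hmul, hψ, hψ]
  · intro f g hfg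
    have h0 : Φ (f - g) = 0 := by rw [map_sub, hfg, sub_self]
    obtain ⟨S, hS, h1⟩ := hΦ (f - g)
    rw [h1] at h0
    have h2 : S 0 = 0 := hS.1.map_zero
    exact sub_eq_zero.1 (hS.2.2.1 (h0.trans h2.symm))
  · intro h
    choose k hk using fun x => hsurj x (h x)
    have hkc : Continuous k := by
      rw [continuous_iff_continuousAt]
      intro x0
      obtain ⟨u, r, hu, -, hr1, -⟩ := bump (p := φ x0) Filter.univ_mem
      have h1 : ∀ᶠ x in nhds x0, r (φ x) = 1 := φ.continuous.continuousAt.eventually hr1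
      have h2 : ∀ᶠ x in nhds x0,
          ‖k x - k x0‖ ≤ ‖Φ‖ * ‖h x - Φ (tens (k x0) u) x‖ := by
        filter_upwards [h1] with x hx
        have h3 := hbd x (k x - k x0)
        rw [map_sub, hk] at h3
        rw [hψ, tens_apply, hu, hx]
        simpa using h3
      have h3 : Filter.Tendsto (fun x => ‖Φ‖ * ‖h x - Φ (tens (k x0) u) x‖) (nhds x0) (nhds 0) := by
        have h4 := ((((map_continuous h).sub
          (map_continuous (Φ (tens (k x0) u)))).norm.const_mul ‖Φ‖).tendsto x0)
        have h5 : Φ (tens (k x0) u) x0 = h x0 := by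
          rw [hψ, tens_apply, hu, hr1.self_of_nhds, ← hk x0]; simp
        simp only [Pi.sub_apply] at h4
        rw [h5, sub_self, norm_zero, mul_zero] at h4
        exact h4
      rw [ContinuousAt, tendsto_iff_norm_sub_tendsto_zero]
      exact squeeze_zero' (Filter.Eventually.of_forall fun _ => norm_nonneg _) h2 h3
    obtain ⟨K, hK⟩ := exists_c0 hkc h (C := ‖Φ‖) (fun x => by
      have := hbd x (k x)
      rwa [hk] at this)
    refine ⟨K.comp φ.symm.toCocompactMap, ?_⟩
    ext1 x
    rw [hψ]
    have h1 : (K.comp φ.symm.toCocompactMap) (φ x) = K (φ.symm (φ x)) := rfl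
    rw [h1, φ.symm_apply_apply, hK, hk]
end
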